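/- arXiv:2210.11110 — 3 statements merged into one kernel-verified Lean document; each statement's English description precedes it below -/
import Mathlib

section
/- Let f be a homeomorphism of the closed annulus A = 𝕋 × [0,1] isotopic to the identity, f̃ a lift of f to Ã = ℝ × [0,1], and X ⊆ A a nonempty well ordered f-invariant closed set whose rotation number ρ_{f̃}(X) is irrational. Then X contains a smallest nonempty closed f-invariant subset Y (i.e., Y is contained in every nonempty closed f-invariant subset of X), and Y is either the graph {(x, ψ(x)) : x ∈ 𝕋} of a continuous function ψ : 𝕋 → [0,1], or a Cantor set (a nonempty compact, perfect, totally disconnected set). -/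
open Set Filter Topology MeasureTheory

noncomputable section

/-- The circle `𝕋 = ℝ/ℤ`. -/
abbrev 𝕋 : Type := AddCircle (1 : ℝ)

/-- The closed annulus `A = 𝕋 × [0,1]`. -/
abbrev Ann : Type := 𝕋 × ↥(Set.Icc (0:ℝ) 1)

/-- The universal cover `Ã = ℝ × [0,1]`. -/
abbrev StripA : Type := ℝ × ↥(Set.Icc (0:ℝ) 1)

/-- The covering projection `π : Ã → A`. -/
def annProj : StripA → Ann := fun z => ((z.1 : 𝕋), z.2)

/-- The deck translation `T(x̃,y) = (x̃+1,y)`. -/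
def deckT : StripA → StripA := fun z => (z.1 + 1, z.2)

/-- The iterated deck translation `T^p`, `p ∈ ℤ`. -/
def deckZ (p : ℤ) : StripA → StripA := fun z => (z.1 + (p : ℝ), z.2)

/-- The boundary circle `C₀ = 𝕋 × {0}`. -/
def C0 : Set Ann := {z | (z.2 : ℝ) = 0}

/-- The boundary circle `C₁ = 𝕋 × {1}`. -/
def C1 : Set Ann := {z | (z.2 : ℝ) = 1}

/-- A point of `Ã` on the boundary line `ℝ × {0}`. -/
def bd0 (x : ℝ) : StripA := (x, ⟨0, by norm_num⟩)

/-- A point of `Ã` on the boundary line `ℝ × {1}`. -/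
def bd1 (x : ℝ) : StripA := (x, ⟨1, by norm_num⟩)

/-- A homeomorphism of the closed annulus isotopic to the identity, together with a
chosen lift to the universal cover.  (A homeomorphism of `A` is isotopic to the identity
iff it admits a lift commuting with the deck translation and preserving each boundary
line of the strip.) -/
structure AnnulusHomeo where
  toFun : Ann ≃ₜ Ann
  lift : StripA ≃ₜ StripA
  lift_proj : ∀ z : StripA, annProj (lift z) = toFun (annProj z)
  lift_deck : ∀ z : StripA, lift (deckT z) = deckT (lift z)
  lift_bd0 : ∀ z : StripA, (z.2 : ℝ) = 0 → ((lift z).2 : ℝ) = 0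

/-- The iterate `f^k`, `k ∈ ℤ`. -/
def AnnulusHomeo.iter (h : AnnulusHomeo) (k : ℤ) : Ann → Ann :=
  fun z => ((h.toFun.toEquiv : Equiv.Perm Ann) ^ k) z

/-- The iterate `f̃^k` of the lift, `k ∈ ℤ`. -/
def AnnulusHomeo.liftIter (h : AnnulusHomeo) (k : ℤ) : StripA → StripA :=
  fun z => ((h.lift.toEquiv : Equiv.Perm StripA) ^ k) z

/-- `f` is non wandering: every nonempty open set meets one of its forward iterates. -/
def NonWandering (h : AnnulusHomeo) : Prop :=
  ∀ U : Set Ann, IsOpen U → U.Nonempty → ∃ k : ℕ, 0 < k ∧ (h.iter k '' U ∩ U).Nonempty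

/-- The closed strip `ℝ × [0,1]` inside the plane. -/
def stripS : Set (ℝ × ℝ) := {p | p.2 ∈ Set.Icc (0:ℝ) 1}

/-- A positive twist map: a `C¹` diffeomorphism of the annulus, isotopic to the identity,
whose lift `F` to the strip (together with its inverse `G`) is continuously differentiable
and satisfies `∂(p̃₁ ∘ f̃)/∂y > 0`, i.e. the first component of `DF(z)·(0,1)` is positive. -/
structure PositiveTwistMap extends AnnulusHomeo where
  F : ℝ × ℝ → ℝ × ℝ
  F' : ℝ × ℝ → (ℝ × ℝ) →L[ℝ] (ℝ × ℝ)
  G : ℝ × ℝ → ℝ × ℝ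
  G' : ℝ × ℝ → (ℝ × ℝ) →L[ℝ] (ℝ × ℝ)
  F_lift : ∀ z : StripA, F (z.1, (z.2 : ℝ)) = ((lift z).1, ((lift z).2 : ℝ))
  G_lift : ∀ z : StripA, G (z.1, (z.2 : ℝ)) = ((lift.symm z).1, ((lift.symm z).2 : ℝ))
  F_hasDeriv : ∀ z ∈ stripS, HasFDerivWithinAt F (F' z) stripS z
  G_hasDeriv : ∀ z ∈ stripS, HasFDerivWithinAt G (G' z) stripS z
  F'_cont : ContinuousOn F' stripS
  G'_cont : ContinuousOn G' stripS
  twist_pos : ∀ z ∈ stripS, 0 < (F' z (0, 1)).1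

/-- The oriented angle (in `(-π, π]`) from the vertical vector `(0,1)` to the vector `w`. -/
def angleFromVertical (w : ℝ × ℝ) : ℝ := Complex.arg ⟨w.2, -w.1⟩

/-- `ρ` is the rotation number of `f` on the boundary circle `C₀`, computed with the lift. -/
def HasRotNum0 (h : AnnulusHomeo) (ρ : ℝ) : Prop :=
  ∀ x : ℝ, Tendsto (fun n : ℕ => ((h.liftIter (n : ℤ) (bd0 x)).1 - x) / (n : ℝ))
    atTop (𝓝 ρ)

/-- `ρ` is the rotation number of `f` on the boundary circle `C₁`, computed with the lift. -/
def HasRotNum1 (h : AnnulusHomeo) (ρ : ℝ) : Prop :=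
  ∀ x : ℝ, Tendsto (fun n : ℕ => ((h.liftIter (n : ℤ) (bd1 x)).1 - x) / (n : ℝ))
    atTop (𝓝 ρ)

/-- A closed `f`-invariant set `X ⊆ A` is well ordered if the first projection is injective
on `X` and the lift preserves the horizontal order on `π⁻¹(X)`. -/
def IsWellOrdered (h : AnnulusHomeo) (X : Set Ann) : Prop :=
  IsClosed X ∧ h.toFun '' X = X ∧
  Set.InjOn (fun z : Ann => z.1) X ∧
  ∀ z₁ z₂ : StripA, annProj z₁ ∈ X → annProj z₂ ∈ X → z₁.1 < z₂.1 →
    (h.lift z₁).1 < (h.lift z₂).1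

/-- An essential simple loop in the annulus: the range of an injective continuous map
from the circle that is not null-homotopic. -/
def IsEssentialSimpleLoop (Γ : Set Ann) : Prop :=
  ∃ γ : C(𝕋, Ann), Function.Injective γ ∧ ¬ γ.Nullhomotopic ∧ Set.range γ = Γ

/-- `Γ` meets each vertical segment `{x} × [0,1]` in exactly one point. -/
def MeetsVerticalsOnce (Γ : Set Ann) : Prop :=
  ∀ x : 𝕋, ∃! z : Ann, z ∈ Γ ∧ z.1 = x

/-- No essential simple loop meeting each vertical segment exactly once is invariant,
except the two boundary circles. -/
def NoInvariantTransverseLoop (h : AnnulusHomeo) : Prop :=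
  ∀ Γ : Set Ann, IsEssentialSimpleLoop Γ → MeetsVerticalsOnce Γ →
    h.toFun '' Γ = Γ → Γ = C0 ∨ Γ = C1

/-- A continuum: a nonempty compact connected set. -/
def IsContinuum (X : Set Ann) : Prop := X.Nonempty ∧ IsCompact X ∧ IsPreconnected X

/-- A lower annulus: an open set homeomorphic to `𝕋 × [0,1)` containing `C₀`. -/
def IsLowerAnnulus (U : Set Ann) : Prop :=
  IsOpen U ∧ Nonempty (↥U ≃ₜ (𝕋 × ↥(Set.Ico (0:ℝ) 1))) ∧ C0 ⊆ U

/-- A lower disk: an open set homeomorphic to `ℝ × [0,1)` meeting `C₀`. -/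
def IsLowerDisk (U : Set Ann) : Prop :=
  IsOpen U ∧ Nonempty (↥U ≃ₜ (ℝ × ↥(Set.Ico (0:ℝ) 1))) ∧ (U ∩ C0).Nonempty

/-- A lower annulus is regular if it is a connected component of the complement of an
essential simple loop. -/
def IsRegularLowerAnnulus (U : Set Ann) : Prop :=
  ∃ Γ : Set Ann, IsEssentialSimpleLoop Γ ∧ ∃ z : Ann, U = connectedComponentIn Γᶜ z

/-- A lower disk is regular if it is a connected component of the complement of a simple
arc joining two points of `C₀` and meeting `C₀` only at its endpoints, or of the
complement of an essential simple loop meeting `C₀` in exactly one point. -/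
def IsRegularLowerDisk (U : Set Ann) : Prop :=
  (∃ a : C(↥(Set.Icc (0:ℝ) 1), Ann), Function.Injective a ∧
      (∀ t : ↥(Set.Icc (0:ℝ) 1), a t ∈ C0 ↔ ((t : ℝ) = 0 ∨ (t : ℝ) = 1)) ∧
      ∃ z : Ann, U = connectedComponentIn (Set.range a)ᶜ z) ∨
  (∃ Γ : Set Ann, IsEssentialSimpleLoop Γ ∧ (∃! z : Ann, z ∈ Γ ∩ C0) ∧
      ∃ z : Ann, U = connectedComponentIn Γᶜ z)

end

/-- The first coordinates of the points of `Ã` lying over `Z`. -/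
def liftedBase (Z : Set Ann) : Set ℝ := {r | ∃ z : StripA, annProj z ∈ Z ∧ z.1 = r}

/-- The deck-translated iterate `T^p ∘ f̃^k`. -/
def AnnulusHomeo.deckIter (f : AnnulusHomeo) (k p : ℤ) : StripA → StripA :=
  fun z => deckZ p (f.liftIter k z)

lemma annProj_surjective : Function.Surjective annProj := by
  rintro ⟨x, y⟩
  obtain ⟨r, rfl⟩ := QuotientAddGroup.mk_surjective x
  exact ⟨(r, y), rfl⟩

lemma liftedBase_eq_preimage (Z : Set Ann) :
    liftedBase Z = (fun r : ℝ => (r : 𝕋)) ⁻¹' (Prod.fst '' Z) := by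
  ext r
  constructor
  · rintro ⟨z, hz, rfl⟩
    exact ⟨annProj z, hz, rfl⟩
  · rintro ⟨⟨x, y⟩, hz, hx⟩
    refine ⟨(r, y), ?_, rfl⟩
    change x = (r : 𝕋) at hx
    subst hx
    exact hz

lemma isClosed_liftedBase {Z : Set Ann} (hZ : IsClosed Z) : IsClosed (liftedBase Z) := by
  rw [liftedBase_eq_preimage]
  have hc : IsClosed (Prod.fst '' Z) := (hZ.isCompact.image continuous_fst).isClosed
  exact hc.preimage (AddCircle.continuous_mk' (1 : ℝ))

lemma annProj_deckZ (p : ℤ) (z : StripA) : annProj (deckZ p z) = annProj z := by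
  refine Prod.ext ?_ rfl
  change ((z.1 + (p : ℝ) : ℝ) : 𝕋) = (z.1 : 𝕋)
  rw [AddCircle.coe_add, add_eq_left, AddCircle.coe_eq_zero_iff]
  exact ⟨p, by simp⟩

lemma exists_add_int_of_coe_eq {r s : ℝ} (h : (r : 𝕋) = (s : 𝕋)) : ∃ p : ℤ, r = s + p := by
  have h0 : ((r - s : ℝ) : 𝕋) = 0 := by rw [AddCircle.coe_sub, h, sub_self]
  obtain ⟨n, hn⟩ := (AddCircle.coe_eq_zero_iff (1 : ℝ)).1 h0
  refine ⟨n, ?_⟩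
  simp only [zsmul_eq_mul, mul_one] at hn
  linarith

lemma deckZ_deckZ (p q : ℤ) (z : StripA) : deckZ p (deckZ q z) = deckZ (p + q) z := by
  refine Prod.ext ?_ rfl
  simp only [deckZ]
  push_cast
  ring

lemma deckZ_zero (z : StripA) : deckZ 0 z = z := Prod.ext (by simp [deckZ]) rfl

lemma deckZ_one (z : StripA) : deckZ 1 z = deckT z := Prod.ext (by simp [deckZ, deckT]) rfl

lemma AnnulusHomeo.lift_deckZ (f : AnnulusHomeo) (p : ℤ) (z : StripA) :
    f.lift (deckZ p z) = deckZ p (f.lift z) := by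
  have h1 : ∀ w, f.lift (deckZ 1 w) = deckZ 1 (f.lift w) := fun w => by
    rw [deckZ_one, f.lift_deck, deckZ_one]
  have hneg : ∀ w, f.lift (deckZ (-1) w) = deckZ (-1) (f.lift w) := fun w => by
    have := h1 (deckZ (-1) w)
    rw [deckZ_deckZ, add_neg_cancel, deckZ_zero] at this
    rw [this, deckZ_deckZ, neg_add_cancel, deckZ_zero]
  induction p using Int.induction_on with
  | zero => simp only [deckZ_zero]
  | succ n ih => rw [add_comm, ← deckZ_deckZ, h1, ih, deckZ_deckZ]
  | pred n ih => rw [sub_eq_neg_add, ← deckZ_deckZ, hneg, ih, deckZ_deckZ]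

lemma AnnulusHomeo.liftIter_zero (f : AnnulusHomeo) (z : StripA) : f.liftIter 0 z = z := rfl

lemma AnnulusHomeo.liftIter_add (f : AnnulusHomeo) (k m : ℤ) (z : StripA) :
    f.liftIter (k + m) z = f.liftIter k (f.liftIter m z) := by
  simp only [liftIter, zpow_add, Equiv.Perm.mul_apply]

lemma AnnulusHomeo.liftIter_one (f : AnnulusHomeo) (z : StripA) : f.liftIter 1 z = f.lift z := by
  simp [liftIter]

lemma AnnulusHomeo.liftIter_neg_one (f : AnnulusHomeo) (z : StripA) :
    f.liftIter (-1) z = f.lift.symm z := by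
  apply f.lift.injective
  rw [← f.liftIter_one, ← f.liftIter_add, add_neg_cancel, f.liftIter_zero,
    f.lift.apply_symm_apply]

/-- Integer iterates of the lift inherit any property of pairs of maps that holds for the lift
and its inverse. -/
lemma AnnulusHomeo.liftIter_induction (f : AnnulusHomeo) {P : (StripA → StripA) → Prop}
    (h0 : P id) (h1 : ∀ g, P g → P (f.lift ∘ g)) (hneg : ∀ g, P g → P (f.lift.symm ∘ g))
    (k : ℤ) : P (f.liftIter k) := by
  induction k using Int.induction_on with
  | zero => exact h0
  | succ n ih =>
    have : f.liftIter (n + 1) = f.lift ∘ f.liftIter n := by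
      funext z
      rw [add_comm, f.liftIter_add, f.liftIter_one, Function.comp_apply]
    rw [this]
    exact h1 _ ih
  | pred n ih =>
    have : f.liftIter (-n - 1) = f.lift.symm ∘ f.liftIter (-n) := by
      funext z
      rw [sub_eq_neg_add, f.liftIter_add, f.liftIter_neg_one, Function.comp_apply]
    rw [this]
    exact hneg _ ih

lemma AnnulusHomeo.liftIter_deckZ (f : AnnulusHomeo) (k p : ℤ) (z : StripA) :
    f.liftIter k (deckZ p z) = deckZ p (f.liftIter k z) := by
  refine f.liftIter_induction (P := fun g => ∀ z, g (deckZ p z) = deckZ p (g z))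
    (fun _ => rfl) (fun g hg z => ?_) (fun g hg z => ?_) k z
  · simp only [Function.comp_apply, hg, f.lift_deckZ]
  · apply f.lift.injective
    simp only [Function.comp_apply, hg, f.lift_deckZ, f.lift.apply_symm_apply]

lemma AnnulusHomeo.deckIter_deckIter (f : AnnulusHomeo) (k p m q : ℤ) (z : StripA) :
    f.deckIter k p (f.deckIter m q z) = f.deckIter (k + m) (p + q) z := by
  simp only [deckIter, f.liftIter_deckZ, deckZ_deckZ, f.liftIter_add]

lemma AnnulusHomeo.deckIter_zero (f : AnnulusHomeo) (z : StripA) : f.deckIter 0 0 z = z := by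
  rw [deckIter, f.liftIter_zero, deckZ_zero]

lemma AnnulusHomeo.deckIter_fst (f : AnnulusHomeo) (k p : ℤ) (z : StripA) :
    (f.deckIter k p z).1 = (f.liftIter k z).1 + p := rfl

section Invariant

variable {f : AnnulusHomeo} {X Z : Set Ann}

lemma AnnulusHomeo.apply_mem_iff (hZ : f.toFun '' Z = Z) (x : Ann) : f.toFun x ∈ Z ↔ x ∈ Z := by
  conv_lhs => rw [← hZ]
  exact f.toFun.injective.mem_set_image

lemma AnnulusHomeo.annProj_lift_mem (hZ : f.toFun '' Z = Z) {z : StripA}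
    (hz : annProj z ∈ Z) : annProj (f.lift z) ∈ Z := by
  rw [f.lift_proj]
  exact (f.apply_mem_iff hZ _).2 hz

lemma AnnulusHomeo.annProj_lift_symm_mem (hZ : f.toFun '' Z = Z) {z : StripA}
    (hz : annProj z ∈ Z) : annProj (f.lift.symm z) ∈ Z := by
  rwa [← f.apply_mem_iff hZ, ← f.lift_proj, f.lift.apply_symm_apply]

lemma AnnulusHomeo.annProj_liftIter_mem (hZ : f.toFun '' Z = Z) {z : StripA}
    (hz : annProj z ∈ Z) (k : ℤ) : annProj (f.liftIter k z) ∈ Z :=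
  f.liftIter_induction (P := fun g => annProj (g z) ∈ Z) hz
    (fun _ hg => f.annProj_lift_mem hZ hg) (fun _ hg => f.annProj_lift_symm_mem hZ hg) k

lemma AnnulusHomeo.annProj_deckIter_mem (hZ : f.toFun '' Z = Z) {z : StripA}
    (hz : annProj z ∈ Z) (k p : ℤ) : annProj (f.deckIter k p z) ∈ Z := by
  rw [deckIter, annProj_deckZ]
  exact f.annProj_liftIter_mem hZ hz k

lemma eq_of_fst_eq_of_injOn (hX : Set.InjOn (fun z : Ann => z.1) X) {z w : StripA}
    (hz : annProj z ∈ X) (hw : annProj w ∈ X) (h : z.1 = w.1) : z = w := by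
  have h' : annProj z = annProj w := hX hz hw (congrArg (fun r : ℝ => (r : 𝕋)) h)
  exact Prod.ext h (congrArg (fun a : Ann => a.2) h')

lemma IsWellOrdered.lift_symm_lt (hX : IsWellOrdered f X) {z w : StripA} (hz : annProj z ∈ X)
    (hw : annProj w ∈ X) (h : z.1 < w.1) : (f.lift.symm z).1 < (f.lift.symm w).1 := by
  obtain ⟨-, hinv, hinj, hord⟩ := hX
  have hz' := f.annProj_lift_symm_mem hinv hz
  have hw' := f.annProj_lift_symm_mem hinv hw
  by_contra! hle
  rcases hle.lt_or_eq with hlt | heq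
  · have := hord _ _ hw' hz' hlt
    simp only [f.lift.apply_symm_apply] at this
    exact this.not_gt h
  · have := eq_of_fst_eq_of_injOn hinj hw' hz' heq
    rw [f.lift.symm.injective this] at h
    exact lt_irrefl _ h

lemma IsWellOrdered.deckIter_lt (hX : IsWellOrdered f X) {z w : StripA} (hz : annProj z ∈ X)
    (hw : annProj w ∈ X) (h : z.1 < w.1) (k p : ℤ) :
    (f.deckIter k p z).1 < (f.deckIter k p w).1 := by
  rw [f.deckIter_fst, f.deckIter_fst, add_lt_add_iff_right]
  refine (f.liftIter_induction
    (P := fun g => annProj (g z) ∈ X ∧ annProj (g w) ∈ X ∧ (g z).1 < (g w).1)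
    ⟨hz, hw, h⟩ (fun g hg => ?_) (fun g hg => ?_) k).2.2
  · exact ⟨f.annProj_lift_mem hX.2.1 hg.1, f.annProj_lift_mem hX.2.1 hg.2.1,
      hX.2.2.2 _ _ hg.1 hg.2.1 hg.2.2⟩
  · exact ⟨f.annProj_lift_symm_mem hX.2.1 hg.1, f.annProj_lift_symm_mem hX.2.1 hg.2.1,
      hX.lift_symm_lt hg.1 hg.2.1 hg.2.2⟩

lemma IsWellOrdered.deckIter_le (hX : IsWellOrdered f X) {z w : StripA} (hz : annProj z ∈ X)
    (hw : annProj w ∈ X) (h : z.1 ≤ w.1) (k p : ℤ) :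
    (f.deckIter k p z).1 ≤ (f.deckIter k p w).1 := by
  rcases h.lt_or_eq with h | h
  · exact (hX.deckIter_lt hz hw h k p).le
  · rw [eq_of_fst_eq_of_injOn hX.2.2.1 hz hw h]

/-- `ρ` is the rotation number of `X` for the lift of `f`. -/
def HasRotationNumber (f : AnnulusHomeo) (X : Set Ann) (ρ : ℝ) : Prop :=
  ∀ z : StripA, annProj z ∈ X → ∀ k : ℤ,
    -1 < (f.liftIter k z).1 - z.1 - (k : ℝ) * ρ ∧
      (f.liftIter k z).1 - z.1 - (k : ℝ) * ρ < 1

lemma IsWellOrdered.deckIter_fst_lt_of_neg (hX : IsWellOrdered f X) {ρ : ℝ}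
    (hrot : HasRotationNumber f X ρ) {z : StripA} (hz : annProj z ∈ X) {k p : ℤ}
    (h : k * ρ + p < 0) : (f.deckIter k p z).1 < z.1 := by
  by_contra! hle
  have hiter : ∀ n : ℕ, z.1 ≤ (f.deckIter (n * k) (n * p) z).1 := by
    intro n
    induction n with
    | zero => simp [f.deckIter_zero]
    | succ n ih =>
      have h1 := hX.deckIter_le hz (f.annProj_deckIter_mem hX.2.1 hz _ _) ih k p
      rw [f.deckIter_deckIter] at h1
      have e1 : ((n + 1 : ℕ) : ℤ) * k = k + n * k := by push_cast; ring
      have e2 : ((n + 1 : ℕ) : ℤ) * p = p + n * p := by push_cast; ring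
      rw [e1, e2]
      exact hle.trans h1
  obtain ⟨n, hn⟩ := exists_nat_gt (1 / -(k * ρ + p))
  rw [div_lt_iff₀ (by linarith)] at hn
  have h1 := hiter n
  have h2 := (hrot z hz (n * k)).2
  rw [f.deckIter_fst] at h1
  push_cast at h1 h2
  nlinarith

/-- Orbits in a well ordered set are ordered like the orbits of the rotation. -/
lemma IsWellOrdered.deckIter_fst_lt (hX : IsWellOrdered f X) {ρ : ℝ}
    (hrot : HasRotationNumber f X ρ) {z : StripA} (hz : annProj z ∈ X) {k p m q : ℤ}
    (h : k * ρ + p < m * ρ + q) : (f.deckIter k p z).1 < (f.deckIter m q z).1 := by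
  have h1 : (f.deckIter (k - m) (p - q) z).1 < z.1 := by
    apply hX.deckIter_fst_lt_of_neg hrot hz
    push_cast
    linarith
  have h2 := hX.deckIter_lt (f.annProj_deckIter_mem hX.2.1 hz _ _) hz h1 m q
  rwa [f.deckIter_deckIter, add_sub_cancel, add_sub_cancel] at h2

end Invariant

lemma exists_int_combination_between {ρ : ℝ} (hρ : Irrational ρ) {a b : ℝ} (hab : a < b) :
    ∃ k p : ℤ, a < k * ρ + p ∧ k * ρ + p < b := by
  have hd : Dense (AddSubgroup.closure {ρ, 1} : Set ℝ) :=
    dense_addSubgroupClosure_pair_iff.2 (by simpa using hρ)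
  obtain ⟨x, hx, h1, h2⟩ := hd.exists_between hab
  obtain ⟨k, p, rfl⟩ := AddSubgroup.mem_closure_pair.1 hx
  simp only [zsmul_eq_mul, mul_one] at h1 h2
  exact ⟨k, p, h1, h2⟩

/-- The supremum of the points of the orbit of `z` whose rotation index is below `t`. -/
noncomputable def orbitSup (f : AnnulusHomeo) (ρ : ℝ) (z : StripA) (t : ℝ) : ℝ :=
  sSup {r | ∃ k p : ℤ, k * ρ + p < t ∧ r = (f.deckIter k p z).1}

section Orbit

variable {f : AnnulusHomeo} {X Z : Set Ann} {ρ : ℝ}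

lemma nonempty_orbitSup_set (hirr : Irrational ρ) (z : StripA) (t : ℝ) :
    {r | ∃ k p : ℤ, k * ρ + p < t ∧ r = (f.deckIter k p z).1}.Nonempty := by
  obtain ⟨k, p, -, h⟩ := exists_int_combination_between hirr (sub_one_lt t)
  exact ⟨_, k, p, h, rfl⟩

lemma IsWellOrdered.bddAbove_orbitSup_set (hX : IsWellOrdered f X) (hirr : Irrational ρ)
    (hrot : HasRotationNumber f X ρ) {z : StripA} (hz : annProj z ∈ X) (t : ℝ) :
    BddAbove {r | ∃ k p : ℤ, k * ρ + p < t ∧ r = (f.deckIter k p z).1} := by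
  obtain ⟨m, q, h, -⟩ := exists_int_combination_between hirr (lt_add_one t)
  refine ⟨(f.deckIter m q z).1, ?_⟩
  rintro _ ⟨k, p, hkp, rfl⟩
  exact (hX.deckIter_fst_lt hrot hz (hkp.trans h)).le

lemma IsWellOrdered.orbitSup_mem_liftedBase (hX : IsWellOrdered f X) (hirr : Irrational ρ)
    (hrot : HasRotationNumber f X ρ) (hZX : Z ⊆ X) (hZc : IsClosed Z) (hZ : f.toFun '' Z = Z)
    {z : StripA} (hz : annProj z ∈ Z) (t : ℝ) : orbitSup f ρ z t ∈ liftedBase Z := by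
  have hcl := csSup_mem_closure (nonempty_orbitSup_set (f := f) hirr z t)
    (hX.bddAbove_orbitSup_set hirr hrot (hZX hz) t)
  refine (isClosed_liftedBase hZc).closure_subset_iff.2 ?_ hcl
  rintro _ ⟨k, p, -, rfl⟩
  exact ⟨_, f.annProj_deckIter_mem hZ hz k p, rfl⟩

/-- A point of `Ã` over `X` cuts every orbit over `X` at some rotation index. -/
lemma IsWellOrdered.exists_cut (hX : IsWellOrdered f X) (hrot : HasRotationNumber f X ρ)
    {z w : StripA} (hz : annProj z ∈ X) :
    ∃ t : ℝ, (∀ k p : ℤ, k * ρ + p < t → (f.deckIter k p z).1 < w.1) ∧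
      ∀ k p : ℤ, t < k * ρ + p → w.1 < (f.deckIter k p z).1 := by
  set S : Set ℝ := {r | ∃ k p : ℤ, (f.deckIter k p z).1 ≤ w.1 ∧ r = k * ρ + p} with hS
  have hne : S.Nonempty := by
    refine ⟨_, 0, ⌊w.1 - z.1⌋, ?_, rfl⟩
    rw [f.deckIter_fst, f.liftIter_zero]
    linarith [Int.floor_le (w.1 - z.1)]
  have hbdd : BddAbove S := by
    refine ⟨w.1 - z.1 + 1, ?_⟩
    rintro _ ⟨k, p, h, rfl⟩
    rw [f.deckIter_fst] at h
    linarith [(hrot z hz k).1]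
  refine ⟨sSup S, fun k p h => ?_, fun k p h => ?_⟩
  · obtain ⟨_, ⟨m, q, hmq, rfl⟩, hlt⟩ := exists_lt_of_lt_csSup hne h
    exact (hX.deckIter_fst_lt hrot hz hlt).trans_le hmq
  · by_contra! hle
    exact (le_csSup hbdd ⟨k, p, hle, rfl⟩).not_gt h

lemma IsWellOrdered.exists_orbitSup_eq (hX : IsWellOrdered f X) (hirr : Irrational ρ)
    (hrot : HasRotationNumber f X ρ) {z w : StripA} (hz : annProj z ∈ X) (hw : annProj w ∈ X) :
    ∃ t : ℝ, orbitSup f ρ z t = orbitSup f ρ w 0 := by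
  obtain ⟨t, hlo, hhi⟩ := hX.exists_cut hrot (w := w) hz
  refine ⟨t, le_antisymm ?_ ?_⟩
  · refine csSup_le (nonempty_orbitSup_set hirr z t) ?_
    rintro _ ⟨k, p, hkp, rfl⟩
    obtain ⟨m, q, h1, h2⟩ := exists_int_combination_between hirr (sub_neg.2 hkp)
    have h3 := hlo (k - m) (p - q) (by push_cast; linarith)
    have h4 := hX.deckIter_lt (f.annProj_deckIter_mem hX.2.1 hz _ _) hw h3 m q
    rw [f.deckIter_deckIter, add_sub_cancel, add_sub_cancel] at h4
    exact h4.le.trans (le_csSup (hX.bddAbove_orbitSup_set hirr hrot hw 0) ⟨m, q, h2, rfl⟩)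
  · refine csSup_le (nonempty_orbitSup_set hirr w 0) ?_
    rintro _ ⟨m, q, hmq, rfl⟩
    obtain ⟨k, p, h1, h2⟩ := exists_int_combination_between hirr
      (show t + (m * ρ + q) < t by linarith)
    have h3 := hhi (k - m) (p - q) (by push_cast; linarith)
    have h4 := hX.deckIter_lt hw (f.annProj_deckIter_mem hX.2.1 hz _ _) h3 m q
    rw [f.deckIter_deckIter, add_sub_cancel, add_sub_cancel] at h4
    exact h4.le.trans (le_csSup (hX.bddAbove_orbitSup_set hirr hrot hz t) ⟨k, p, h2, rfl⟩)

/-- All nonempty closed invariant subsets of a well ordered set with irrational rotation number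
share a point. -/
lemma IsWellOrdered.exists_common_point (hX : IsWellOrdered f X) (hne : X.Nonempty)
    (hirr : Irrational ρ) (hrot : HasRotationNumber f X ρ) :
    ∃ x : Ann, ∀ Z : Set Ann, Z ⊆ X → Z.Nonempty → IsClosed Z → f.toFun '' Z = Z → x ∈ Z := by
  obtain ⟨x, hx⟩ := hne
  obtain ⟨w, rfl⟩ := annProj_surjective x
  obtain ⟨y, hy, hys⟩ :=
    hX.orbitSup_mem_liftedBase hirr hrot subset_rfl hX.1 hX.2.1 hx 0
  refine ⟨annProj y, fun Z hZX hZne hZc hZ => ?_⟩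
  obtain ⟨v, hv⟩ := hZne
  obtain ⟨z, rfl⟩ := annProj_surjective v
  obtain ⟨t, ht⟩ := hX.exists_orbitSup_eq hirr hrot (hZX hv) hx
  obtain ⟨y', hy', hys'⟩ := hX.orbitSup_mem_liftedBase hirr hrot hZX hZc hZ hv t
  rwa [eq_of_fst_eq_of_injOn hX.2.2.1 hy (hZX hy') (by rw [hys, hys', ht])]

lemma IsWellOrdered.injective_annProj_liftIter (hX : IsWellOrdered f X) (hirr : Irrational ρ)
    (hrot : HasRotationNumber f X ρ) {z : StripA} (hz : annProj z ∈ X) :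
    Function.Injective (fun k : ℤ => annProj (f.liftIter k z)) := by
  intro k m hkm
  obtain ⟨q, hq⟩ := exists_add_int_of_coe_eq
    (congrArg Prod.fst hkm : ((f.liftIter k z).1 : 𝕋) = ((f.liftIter m z).1 : 𝕋))
  have h0 : (f.deckIter k 0 z).1 = (f.deckIter m q z).1 := by
    simp only [f.deckIter_fst, Int.cast_zero, add_zero, hq]
  have heq : k * ρ + (0 : ℤ) = m * ρ + q := by
    rcases lt_trichotomy (k * ρ + (0 : ℤ)) (m * ρ + q) with h | h | h
    · exact absurd h0 (hX.deckIter_fst_lt hrot hz h).ne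
    · exact h
    · exact absurd h0 (hX.deckIter_fst_lt hrot hz h).ne'
  by_contra hne
  have hne' : k - m ≠ 0 := sub_ne_zero.2 hne
  apply (hirr.intCast_mul hne').ne_int q
  push_cast at heq ⊢
  linarith

end Orbit

/-- A closed set of reals that is unbounded in both directions and is not the whole line has
a bounded complementary gap. -/
lemma exists_gap_of_isClosed {K : Set ℝ} (hK : IsClosed K) (hlo : ∀ y, ∃ a ∈ K, a ≤ y)
    (hhi : ∀ y, ∃ b ∈ K, y ≤ b) (hne : K ≠ univ) :
    ∃ c ∈ K, ∃ d ∈ K, c < d ∧ ∀ r ∈ K, ¬ (c < r ∧ r < d) := by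
  obtain ⟨y, hy⟩ := (ne_univ_iff_exists_notMem K).1 hne
  have hb : BddAbove (K ∩ Iic y) := ⟨y, fun _ h => h.2⟩
  have hb' : BddBelow (K ∩ Ici y) := ⟨y, fun _ h => h.2⟩
  have hc := (hK.inter isClosed_Iic).csSup_mem (hlo y) hb
  have hd := (hK.inter isClosed_Ici).csInf_mem (hhi y) hb'
  refine ⟨_, hc.1, _, hd.1, ?_, ?_⟩
  · refine lt_of_le_of_ne (hc.2.trans hd.2) fun h => hy ?_
    rw [← le_antisymm hc.2 (hd.2.trans h.ge)]
    exact hc.1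
  · rintro r hr ⟨h1, h2⟩
    rcases le_total r y with h | h
    · exact h1.not_ge (le_csSup hb ⟨hr, h⟩)
    · exact h2.not_ge (csInf_le hb' ⟨hr, h⟩)

/-- A nondegenerate proper connected subset of the circle contains an arc. -/
lemma IsPreconnected.exists_Ioo_subset_circle {S : Set 𝕋} (hS : IsPreconnected S) {a : 𝕋}
    (ha : a ∉ S) (hnt : S.Nontrivial) :
    ∃ b c : ℝ, b < c ∧ ∀ r ∈ Ioo b c, (r : 𝕋) ∈ S := by
  obtain ⟨a, rfl⟩ := QuotientAddGroup.mk_surjective a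
  have : Fact ((0 : ℝ) < 1) := ⟨one_pos⟩
  let g : 𝕋 → ℝ := fun x => AddCircle.equivIco (1 : ℝ) a x
  have hg : ∀ x, (g x : 𝕋) = x := fun x => (AddCircle.equivIco (1 : ℝ) a).symm_apply_apply x
  have hcont : ContinuousOn g S := fun x hx =>
    (continuous_subtype_val.continuousAt.comp (AddCircle.continuousAt_equivIco 1 a
      (fun h => ha (h ▸ hx)))).continuousWithinAt
  have hconn : OrdConnected (g '' S) := (hS.image g hcont).ordConnected
  have key : ∀ x ∈ S, ∀ y ∈ S, ∀ r ∈ Ioo (g x) (g y), (r : 𝕋) ∈ S := by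
    intro x hx y hy r hr
    obtain ⟨s, hs, rfl⟩ := hconn.out ⟨x, hx, rfl⟩ ⟨y, hy, rfl⟩ (Ioo_subset_Icc_self hr)
    rwa [hg]
  obtain ⟨x, hx, y, hy, hxy⟩ := hnt
  have hne : g x ≠ g y := fun h => hxy (by rw [← hg x, ← hg y, h])
  rcases hne.lt_or_gt with h | h
  · exact ⟨_, _, h, key x hx y hy⟩
  · exact ⟨_, _, h, key y hy x hx⟩

/-- A compact subset of the annulus projecting bijectively to the circle is the graph of
a continuous function. -/
lemma exists_continuous_graph {Y : Set Ann} (hYc : IsClosed Y)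
    (hinj : Set.InjOn (fun z : Ann => z.1) Y) (hsurj : ∀ x : 𝕋, ∃ z ∈ Y, z.1 = x) :
    ∃ ψ : 𝕋 → ℝ, Continuous ψ ∧ (∀ x : 𝕋, ψ x ∈ Set.Icc (0:ℝ) 1) ∧
      Y = {z : Ann | (z.2 : ℝ) = ψ z.1} := by
  have hbij : Function.Bijective (fun y : Y => y.1.1) := by
    refine ⟨fun y z h => Subtype.ext (hinj y.2 z.2 h), fun x => ?_⟩
    obtain ⟨z, hz, h⟩ := hsurj x
    exact ⟨⟨z, hz⟩, h⟩
  have : CompactSpace Y := isCompact_iff_compactSpace.1 hYc.isCompact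
  let e : Y ≃ₜ 𝕋 := Continuous.homeoOfEquivCompactToT2 (f := Equiv.ofBijective _ hbij)
    (continuous_fst.comp continuous_subtype_val)
  have he : ∀ y : Y, e y = y.1.1 := fun _ => rfl
  refine ⟨fun x => ((e.symm x).1.2 : ℝ), ?_, fun x => (e.symm x).1.2.2, ?_⟩
  · exact continuous_subtype_val.comp
      (continuous_snd.comp (continuous_subtype_val.comp e.symm.continuous))
  · ext z
    constructor
    · intro hz
      have : e.symm z.1 = ⟨z, hz⟩ := by rw [Homeomorph.symm_apply_eq, he]
      simp only [mem_ofPred_eq, this]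
    · intro hz
      have h1 : (e.symm z.1).1 = z := by
        refine Prod.ext ?_ (Subtype.ext hz.symm)
        rw [← he, e.apply_symm_apply]
      rw [← h1]
      exact (e.symm z.1).2

section Minimal

variable {f : AnnulusHomeo} {X Y : Set Ann} {ρ : ℝ}

lemma IsWellOrdered.perfect_of_minimal (hX : IsWellOrdered f X) (hirr : Irrational ρ)
    (hrot : HasRotationNumber f X ρ) (hYX : Y ⊆ X) (hYne : Y.Nonempty) (hYc : IsClosed Y)
    (hY : f.toFun '' Y = Y)
    (hmin : ∀ Z : Set Ann, Z ⊆ Y → Z.Nonempty → IsClosed Z → f.toFun '' Z = Z → Y ⊆ Z) :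
    Perfect Y := by
  refine ⟨hYc, preperfect_iff_subset_derivedSet.2 (hmin _ ?_ ?_ (isClosed_derivedSet Y) ?_)⟩
  · exact (isClosed_iff_derivedSet_subset Y).1 hYc
  · obtain ⟨y, hy⟩ := hYne
    obtain ⟨z, rfl⟩ := annProj_surjective y
    have hinf : Y.Infinite :=
      infinite_of_injective_forall_mem (hX.injective_annProj_liftIter hirr hrot (hYX hy))
        (fun k => f.annProj_liftIter_mem hY hy k)
    obtain ⟨x, -, hx⟩ := hinf.exists_accPt_of_subset_isCompact hYc.isCompact subset_rfl
    exact ⟨x, hx⟩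
  · have hY' : f.toFun.symm '' Y = Y := by
      rw [Homeomorph.image_symm]
      conv_lhs => rw [← hY]
      exact preimage_image_eq _ f.toFun.injective
    refine Subset.antisymm ?_ fun x hx => ⟨f.toFun.symm x, ?_, f.toFun.apply_symm_apply x⟩
    · conv_rhs => rw [← hY]
      exact f.toFun.continuous.image_derivedSet f.toFun.injective
    · rw [← hY']
      exact f.toFun.symm.continuous.image_derivedSet f.toFun.symm.injective ⟨x, hx, rfl⟩

lemma closure_orbit_invariant (f : AnnulusHomeo) (z : StripA) :
    f.toFun '' closure (range fun k : ℤ => annProj (f.liftIter k z)) =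
      closure (range fun k : ℤ => annProj (f.liftIter k z)) := by
  rw [f.toFun.image_closure, ← range_comp]
  have h : (f.toFun ∘ fun k : ℤ => annProj (f.liftIter k z)) =
      (fun k : ℤ => annProj (f.liftIter k z)) ∘ Equiv.addLeft 1 := by
    funext k
    simp only [Function.comp_apply, Equiv.coe_addLeft, f.liftIter_add, f.liftIter_one, f.lift_proj]
  rw [h, (Equiv.addLeft (1 : ℤ)).surjective.range_comp]

/-- The projection of a minimal set missing a point of the circle contains no arc. -/
lemma IsWellOrdered.not_Ioo_subset_liftedBase (hX : IsWellOrdered f X) (hYX : Y ⊆ X)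
    (hYne : Y.Nonempty) (hYc : IsClosed Y) (hY : f.toFun '' Y = Y)
    (hmin : ∀ Z : Set Ann, Z ⊆ Y → Z.Nonempty → IsClosed Z → f.toFun '' Z = Z → Y ⊆ Z)
    (hne : liftedBase Y ≠ univ) {a b : ℝ} (hab : a < b) : ¬ Ioo a b ⊆ liftedBase Y := by
  intro hsub
  obtain ⟨y, hy⟩ := hYne
  obtain ⟨z, rfl⟩ := annProj_surjective y
  have hdeck : ∀ p : ℤ, z.1 + p ∈ liftedBase Y := fun p =>
    ⟨deckZ p z, by rwa [annProj_deckZ], rfl⟩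
  obtain ⟨_, ⟨c, hc, rfl⟩, _, ⟨d, hd, rfl⟩, hcd, hgap⟩ :=
    exists_gap_of_isClosed (isClosed_liftedBase hYc)
      (fun y => ⟨_, hdeck ⌊y - z.1⌋, by linarith [Int.floor_le (y - z.1)]⟩)
      (fun y => ⟨_, hdeck ⌈y - z.1⌉, by linarith [Int.le_ceil (y - z.1)]⟩) hne
  have hdense : Y ⊆ closure (range fun k : ℤ => annProj (f.liftIter k c)) := by
    refine hmin _ (closure_minimal ?_ hYc) ?_ isClosed_closure (closure_orbit_invariant f c)
    · rintro _ ⟨k, rfl⟩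
      exact f.annProj_liftIter_mem hY hc k
    · exact (range_nonempty _).closure
  let U : Set 𝕋 := (fun r : ℝ => (r : 𝕋)) '' Ioo a b
  have hU : IsOpen U := QuotientAddGroup.isOpenMap_coe _ isOpen_Ioo
  obtain ⟨m, hm⟩ := exists_between hab
  obtain ⟨v, hv, hvm⟩ := hsub hm
  obtain ⟨_, ⟨r, hr, hrk⟩, ⟨k, rfl⟩⟩ := mem_closure_iff.1 (hdense hv) (Prod.fst ⁻¹' U)
    (hU.preimage continuous_fst) ⟨v.1, hvm ▸ hm, rfl⟩
  obtain ⟨p, hp⟩ := exists_add_int_of_coe_eq (s := (f.liftIter k c).1) hrk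
  rw [← f.deckIter_fst] at hp
  have hlt : r < (f.deckIter k p d).1 := hp ▸ hX.deckIter_lt (hYX hc) (hYX hd) hcd k p
  obtain ⟨s, hs1, hs2⟩ := exists_between (lt_min hr.2 hlt)
  obtain ⟨w, hw, rfl⟩ := hsub ⟨hr.1.trans hs1, hs2.trans_le (min_le_left _ _)⟩
  have hwd := hs2.trans_le (min_le_right _ _)
  have hback : ∀ u : StripA, f.deckIter (-k) (-p) (f.deckIter k p u) = u := fun u => by
    rw [f.deckIter_deckIter, neg_add_cancel, neg_add_cancel, f.deckIter_zero]
  have h1 := hX.deckIter_lt (f.annProj_deckIter_mem hX.2.1 (hYX hc) k p) (hYX hw)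
    (hp ▸ hs1) (-k) (-p)
  have h2 := hX.deckIter_lt (hYX hw) (f.annProj_deckIter_mem hX.2.1 (hYX hd) k p) hwd (-k) (-p)
  rw [hback] at h1 h2
  exact hgap _ ⟨_, f.annProj_deckIter_mem hY hw (-k) (-p), rfl⟩ ⟨h1, h2⟩

lemma IsWellOrdered.isTotallyDisconnected_of_minimal (hX : IsWellOrdered f X) (hYX : Y ⊆ X)
    (hYne : Y.Nonempty) (hYc : IsClosed Y) (hY : f.toFun '' Y = Y)
    (hmin : ∀ Z : Set Ann, Z ⊆ Y → Z.Nonempty → IsClosed Z → f.toFun '' Z = Z → Y ⊆ Z)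
    {a : 𝕋} (ha : a ∉ Prod.fst '' Y) : IsTotallyDisconnected Y := by
  intro C hCY hC x hx y hy
  apply hX.2.2.1 (hYX (hCY hx)) (hYX (hCY hy))
  by_contra hxy
  obtain ⟨b, c, hbc, hsub⟩ := (hC.image Prod.fst continuousOn_fst).exists_Ioo_subset_circle
    (fun h => ha (image_mono hCY h))
    ⟨x.1, mem_image_of_mem _ hx, y.1, mem_image_of_mem _ hy, hxy⟩
  refine hX.not_Ioo_subset_liftedBase hYX hYne hYc hY hmin ?_ hbc fun r hr => ?_
  · obtain ⟨r, rfl⟩ := QuotientAddGroup.mk_surjective a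
    intro h
    have : r ∈ liftedBase Y := h ▸ mem_univ r
    rw [liftedBase_eq_preimage] at this
    exact ha this
  · rw [liftedBase_eq_preimage]
    exact image_mono hCY (hsub r hr)

end Minimal

/-- A nonempty well ordered invariant closed set with irrational rotation number contains
a smallest nonempty closed invariant subset, which is either the graph of a continuous
function `𝕋 → [0,1]` or a Cantor set. -/
theorem statement17 (f : AnnulusHomeo) (X : Set Ann) (hne : X.Nonempty)
    (hwo : IsWellOrdered f X) (ρ : ℝ) (hirr : Irrational ρ)
    (hrot : ∀ z : StripA, annProj z ∈ X → ∀ k : ℤ,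
      -1 < (f.liftIter k z).1 - z.1 - (k : ℝ) * ρ ∧
        (f.liftIter k z).1 - z.1 - (k : ℝ) * ρ < 1) :
    ∃ Y : Set Ann, Y ⊆ X ∧ Y.Nonempty ∧ IsClosed Y ∧ f.toFun '' Y = Y ∧
      (∀ Z : Set Ann, Z ⊆ X → Z.Nonempty → IsClosed Z → f.toFun '' Z = Z → Y ⊆ Z) ∧
      ((∃ ψ : 𝕋 → ℝ, Continuous ψ ∧ (∀ x : 𝕋, ψ x ∈ Set.Icc (0:ℝ) 1) ∧
          Y = {z : Ann | (z.2 : ℝ) = ψ z.1}) ∨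
        (IsCompact Y ∧ Perfect Y ∧ IsTotallyDisconnected Y)) := by
  obtain ⟨x, hx⟩ := hwo.exists_common_point hne hirr hrot
  set Y : Set Ann := {y | ∀ Z : Set Ann, Z ⊆ X → Z.Nonempty → IsClosed Z →
    f.toFun '' Z = Z → y ∈ Z} with hYdef
  have hleast : ∀ Z : Set Ann, Z ⊆ X → Z.Nonempty → IsClosed Z → f.toFun '' Z = Z → Y ⊆ Z :=
    fun Z h1 h2 h3 h4 _ hy => hy Z h1 h2 h3 h4
  have hYX : Y ⊆ X := hleast X subset_rfl hne hwo.1 hwo.2.1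
  have hYne : Y.Nonempty := ⟨x, hx⟩
  have hYc : IsClosed Y := by
    simp only [hYdef, ofPred_forall]
    exact isClosed_iInter fun Z => isClosed_iInter fun _ => isClosed_iInter fun _ =>
      isClosed_iInter fun h => isClosed_iInter fun _ => h
  have hYinv : ∀ y, f.toFun y ∈ Y ↔ y ∈ Y := fun y =>
    ⟨fun h Z h1 h2 h3 h4 => (f.apply_mem_iff h4 y).1 (h Z h1 h2 h3 h4),
      fun h Z h1 h2 h3 h4 => (f.apply_mem_iff h4 y).2 (h Z h1 h2 h3 h4)⟩
  have hY : f.toFun '' Y = Y := by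
    refine Subset.antisymm (image_subset_iff.2 fun y hy => (hYinv y).2 hy) fun y hy =>
      ⟨f.toFun.symm y, (hYinv _).1 ?_, f.toFun.apply_symm_apply y⟩
    rwa [f.toFun.apply_symm_apply]
  have hmin : ∀ Z : Set Ann, Z ⊆ Y → Z.Nonempty → IsClosed Z → f.toFun '' Z = Z → Y ⊆ Z :=
    fun Z h => hleast Z (h.trans hYX)
  refine ⟨Y, hYX, hYne, hYc, hY, hleast, ?_⟩
  by_cases hsurj : ∀ a : 𝕋, a ∈ Prod.fst '' Y
  · exact Or.inl (exists_continuous_graph hYc (hwo.2.2.1.mono hYX) hsurj)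
  · push Not at hsurj
    obtain ⟨a, ha⟩ := hsurj
    exact Or.inr ⟨hYc.isCompact,
      hwo.perfect_of_minimal hirr hrot hYX hYne hYc hY hmin,
      hwo.isTotallyDisconnected_of_minimal hYX hYne hYc hY hmin ha⟩
end

section
/- Let f be a positive twist map of the closed annulus A = 𝕋 × [0,1] and f̃ a lift of f to Ã = ℝ × [0,1]. Then ρ_{f̃}(C₀) ≤ ρ_{f̃}(C₁); and if moreover f preserves the measure induced by the area form dx∧dy, then ρ_{f̃}(C₀) < ρ_{f̃}(C₁). -/
open Set Filter Topology MeasureTheory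

namespace AnnulusHomeo

variable (h : AnnulusHomeo)

/-- The first coordinate of the lift on the bottom boundary line. -/
def bottom (x : ℝ) : ℝ := (h.lift (bd0 x)).1

/-- The first coordinate of the lift on the top boundary line. -/
def top (x : ℝ) : ℝ := (h.lift (bd1 x)).1

theorem continuous_bottom : Continuous h.bottom := by
  unfold bottom bd0; fun_prop

theorem continuous_top : Continuous h.top := by
  unfold top bd1; fun_prop

theorem bottom_add_one (x : ℝ) : h.bottom (x + 1) = h.bottom x + 1 :=
  congrArg Prod.fst (h.lift_deck (bd0 x))

theorem top_add_one (x : ℝ) : h.top (x + 1) = h.top x + 1 :=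
  congrArg Prod.fst (h.lift_deck (bd1 x))

theorem lift_bd0_eq (x : ℝ) : h.lift (bd0 x) = bd0 (h.bottom x) :=
  Prod.ext rfl (Subtype.ext (h.lift_bd0 _ rfl))

end AnnulusHomeo

theorem add_natCast_of_add_one {g : ℝ → ℝ} (hg : ∀ x, g (x + 1) = g x + 1) (x : ℝ) (n : ℕ) :
    g (x + n) = g x + n := by
  induction n with
  | zero => simp
  | succ n ih => push_cast; rw [← add_assoc, hg, ih, add_assoc]

theorem add_intCast_of_add_one {g : ℝ → ℝ} (hg : ∀ x, g (x + 1) = g x + 1) (x : ℝ) (n : ℤ) :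
    g (x + n) = g x + n := by
  obtain ⟨k, rfl | rfl⟩ := n.eq_nat_or_neg
  · exact_mod_cast add_natCast_of_add_one hg x k
  · have := add_natCast_of_add_one hg (x - k) k
    rw [sub_add_cancel] at this
    push_cast
    rw [← sub_eq_add_neg]
    linarith

theorem surjective_of_add_one {g : ℝ → ℝ} (hc : Continuous g)
    (hg : ∀ x, g (x + 1) = g x + 1) : Function.Surjective g := by
  intro t
  refine mem_range_of_exists_le_of_exists_ge hc ⟨0 + (⌊t - g 0⌋ : ℤ), ?_⟩ ⟨0 + (⌈t - g 0⌉ : ℤ), ?_⟩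
  · rw [add_intCast_of_add_one hg]; linarith [Int.floor_le (t - g 0)]
  · rw [add_intCast_of_add_one hg]; linarith [Int.le_ceil (t - g 0)]

theorem strictMono_of_add_one {g : ℝ → ℝ} (hc : Continuous g) (hi : Function.Injective g)
    (hg : ∀ x, g (x + 1) = g x + 1) : StrictMono g := by
  refine (hc.strictMono_of_inj hi).resolve_right fun ha => ?_
  have := ha (zero_lt_one' ℝ)
  have := hg 0
  rw [zero_add] at this
  linarith

/-- If `g < u` are continuous and commute with the unit translation, then a uniform
shift fits between them. -/
theorem exists_forall_add_le_of_add_one {g u : ℝ → ℝ} (hc : Continuous g) (hu : Continuous u)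
    (hg : ∀ x, g (x + 1) = g x + 1) (hu1 : ∀ x, u (x + 1) = u x + 1) (hlt : ∀ x, g x < u x) :
    ∃ η > 0, ∀ x, g (x + η) ≤ u x := by
  obtain ⟨x₀, -, hmin⟩ := (isCompact_Icc (a := (0 : ℝ)) (b := 1)).exists_isMinOn
    (nonempty_Icc.2 zero_le_one) (hu.sub hc).continuousOn
  obtain ⟨δ, hδ, huc⟩ := Metric.uniformContinuousOn_iff.1
    ((isCompact_Icc (a := (0 : ℝ)) (b := 2)).uniformContinuousOn_of_continuous hc.continuousOn)
    (u x₀ - g x₀) (sub_pos.2 (hlt x₀))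
  refine ⟨min 1 (δ / 2), by positivity, fun x => ?_⟩
  set η := min 1 (δ / 2) with hη
  have h1 : η ≤ 1 := min_le_left _ _
  have h2 : η ≤ δ / 2 := min_le_right _ _
  have h0 : 0 < η := by positivity
  have key : ∀ y ∈ Icc (0 : ℝ) 1, g (y + η) ≤ u y := by
    intro y hy
    have hd := huc (y + η) ⟨by linarith [hy.1], by linarith [hy.2]⟩ y
      ⟨hy.1, by linarith [hy.2]⟩ (by
        rw [Real.dist_eq, add_sub_cancel_left, abs_of_pos h0]; linarith)
    rw [Real.dist_eq] at hd
    have := hmin hy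
    simp only [mem_ofPred_eq, Pi.sub_apply] at this
    linarith [le_abs_self (g (y + η) - g y)]
  have hk := key (Int.fract x) ⟨Int.fract_nonneg x, (Int.fract_lt_one x).le⟩
  have e1 := add_intCast_of_add_one hu1 (Int.fract x) ⌊x⌋
  have e2 := add_intCast_of_add_one hg (Int.fract x + η) ⌊x⌋
  rw [Int.fract_add_floor] at e1
  rw [add_right_comm, Int.fract_add_floor] at e2
  linarith

theorem AnnulusHomeo.strictMono_bottom (h : AnnulusHomeo) : StrictMono h.bottom := by
  refine strictMono_of_add_one h.continuous_bottom (fun x y hxy => ?_) h.bottom_add_one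
  have : h.lift (bd0 x) = h.lift (bd0 y) := by rw [h.lift_bd0_eq, h.lift_bd0_eq, hxy]
  exact congrArg Prod.fst (h.lift.injective this)

theorem AnnulusHomeo.liftIter_bd0 (h : AnnulusHomeo) (n : ℕ) (x : ℝ) :
    h.liftIter n (bd0 x) = bd0 (h.bottom^[n] x) := by
  induction n generalizing x with
  | zero => simp [liftIter]
  | succ n ih =>
    rw [Function.iterate_succ_apply, ← ih, ← h.lift_bd0_eq]
    simp only [liftIter, zpow_natCast, pow_succ, Equiv.Perm.mul_apply]
    rfl

theorem uniqueDiffOn_stripS : UniqueDiffOn ℝ stripS := by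
  have : stripS = univ ×ˢ Icc (0 : ℝ) 1 := by ext; simp [stripS]
  rw [this]
  exact uniqueDiffOn_univ.prod (uniqueDiffOn_Icc zero_lt_one)

namespace PositiveTwistMap

variable (f : PositiveTwistMap)

/-- The top boundary line is invariant: at an interior image point, the second coordinate of the
inverse would have a critical point. -/
theorem lift_bd1_snd (x : ℝ) : ((f.lift (bd1 x)).2 : ℝ) = 1 := by
  set p := f.lift (bd1 x) with hp
  have hsymm : f.lift.symm p = bd1 x := by simp [hp]
  have h0 : (p.2 : ℝ) ≠ 0 := by
    intro h
    obtain ⟨t, ht⟩ := surjective_of_add_one f.continuous_bottom f.bottom_add_one p.1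
    have h2 : f.lift (bd0 t) = p := by
      rw [f.lift_bd0_eq, ht]
      exact Prod.ext rfl (Subtype.ext h.symm)
    have h3 := congrArg (fun z : StripA => (z.2 : ℝ)) (f.lift.injective (h2.trans hp))
    simp [bd0, bd1] at h3
  by_contra h1
  have hlo : 0 < (p.2 : ℝ) := lt_of_le_of_ne p.2.2.1 (Ne.symm h0)
  have hhi : (p.2 : ℝ) < 1 := lt_of_le_of_ne p.2.2.2 h1
  set P : ℝ × ℝ := (p.1, (p.2 : ℝ)) with hP
  have hPmem : P ∈ stripS := p.2.2
  have hnhds : stripS ∈ 𝓝 P :=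
    continuous_snd.continuousAt.preimage_mem_nhds (Icc_mem_nhds hlo hhi)
  have hGP : (f.G P).2 = 1 := by rw [hP, f.G_lift, hsymm]; rfl
  have hmax : IsLocalMax (fun q => (f.G q).2) P := by
    filter_upwards [hnhds] with q hq
    rw [hGP, f.G_lift (q.1, ⟨q.2, hq⟩)]
    exact (f.lift.symm _).2.2.2
  have hG := (f.G_hasDeriv P hPmem).hasFDerivAt hnhds
  have hcrit := hmax.hasFDerivAt_eq_zero hG.snd
  have hX : ((x, 1) : ℝ × ℝ) ∈ stripS := ⟨zero_le_one, le_rfl⟩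
  have hFX : f.F (x, 1) = P := f.F_lift (bd1 x)
  have hFm : MapsTo f.F stripS stripS := fun q hq => by
    rw [f.F_lift (q.1, ⟨q.2, hq⟩)]; exact (f.lift _).2.2
  have hcomp : HasFDerivWithinAt (f.G ∘ f.F) ((f.G' P).comp (f.F' (x, 1))) stripS (x, 1) := by
    have := f.G_hasDeriv P hPmem
    rw [← hFX] at this ⊢
    exact this.comp _ (f.F_hasDeriv _ hX) hFm
  have hid : HasFDerivWithinAt (f.G ∘ f.F) (ContinuousLinearMap.id ℝ (ℝ × ℝ)) stripS (x, 1) := by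
    have hGF : ∀ q ∈ stripS, (f.G ∘ f.F) q = id q := fun q hq => by
      have e1 := f.F_lift (q.1, ⟨q.2, hq⟩)
      have e2 := f.G_lift (f.lift (q.1, ⟨q.2, hq⟩))
      simp only [Homeomorph.symm_apply_apply] at e2
      exact (congrArg f.G e1).trans e2
    exact (hasFDerivWithinAt_id _ _).congr hGF (hGF _ hX)
  have heq := (uniqueDiffOn_stripS _ hX).eq hcomp hid
  have hone := congrArg (fun L : (ℝ × ℝ) →L[ℝ] (ℝ × ℝ) => (L (0, 1)).2) heq
  have hzero := congrArg (fun L : (ℝ × ℝ) →L[ℝ] ℝ => L (f.F' (x, 1) (0, 1))) hcrit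
  simp at hone hzero
  linarith

theorem lift_bd1_eq (x : ℝ) : f.lift (bd1 x) = bd1 (f.top x) :=
  Prod.ext rfl (Subtype.ext (f.lift_bd1_snd x))

theorem strictMono_top : StrictMono f.top := by
  refine strictMono_of_add_one f.continuous_top (fun x y hxy => ?_) f.top_add_one
  have : f.lift (bd1 x) = f.lift (bd1 y) := by rw [f.lift_bd1_eq, f.lift_bd1_eq, hxy]
  exact congrArg Prod.fst (f.lift.injective this)

theorem liftIter_bd1 (n : ℕ) (x : ℝ) :
    f.toAnnulusHomeo.liftIter n (bd1 x) = bd1 (f.top^[n] x) := by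
  induction n generalizing x with
  | zero => simp [AnnulusHomeo.liftIter]
  | succ n ih =>
    rw [Function.iterate_succ_apply, ← ih, ← f.lift_bd1_eq]
    simp only [AnnulusHomeo.liftIter, zpow_natCast, pow_succ, Equiv.Perm.mul_apply]
    rfl

theorem strictMono_lift_fst (x : ℝ) :
    StrictMono fun y : Icc (0 : ℝ) 1 => (f.lift (x, y)).1 := by
  have hd : ∀ y ∈ Icc (0 : ℝ) 1,
      HasDerivWithinAt (fun y => (f.F (x, y)).1) (f.F' (x, y) (0, 1)).1 (Icc 0 1) y := by
    intro y hy
    have hline : HasDerivWithinAt (fun y : ℝ => (x, y)) ((0, 1) : ℝ × ℝ) (Icc 0 1) y :=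
      (hasDerivWithinAt_const y _ x).prodMk (hasDerivWithinAt_id y _)
    exact (f.F_hasDeriv (x, y) hy).fst.comp_hasDerivWithinAt y hline fun t ht => ht
  have hs : StrictMonoOn (fun y => (f.F (x, y)).1) (Icc (0 : ℝ) 1) :=
    strictMonoOn_of_hasDerivWithinAt_pos (convex_Icc 0 1)
      (fun y hy => (hd y hy).continuousWithinAt)
      (fun y hy => (hd y (interior_subset hy)).mono interior_subset)
      fun y hy => f.twist_pos (x, y) (interior_subset hy : y ∈ Icc (0 : ℝ) 1)
  intro y z hyz
  have := hs y.2 z.2 hyz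
  simpa only [f.F_lift (x, y), f.F_lift (x, z)] using this

theorem bottom_le_lift_fst (z : StripA) : f.bottom z.1 ≤ (f.lift z).1 :=
  (f.strictMono_lift_fst z.1).monotone z.2.2.1

theorem lift_fst_le_top (z : StripA) : (f.lift z).1 ≤ f.top z.1 :=
  (f.strictMono_lift_fst z.1).monotone z.2.2.2

end PositiveTwistMap

/-- The representative in `(0,1] × [0,1]` of a point of the annulus. -/
noncomputable def annSection (w : Ann) : StripA := (AddCircle.measurableEquivIoc 1 0 w.1, w.2)

theorem measurable_annSection : Measurable annSection :=
  (measurable_subtype_coe.comp ((AddCircle.measurableEquivIoc 1 0).measurable.comp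
    measurable_fst)).prodMk measurable_snd

theorem annProj_annSection (w : Ann) : annProj (annSection w) = w :=
  Prod.ext ((AddCircle.measurableEquivIoc 1 0).symm_apply_apply w.1) rfl

theorem deckZ_add (k l : ℤ) (z : StripA) : deckZ (k + l) z = deckZ k (deckZ l z) := by
  refine Prod.ext ?_ rfl
  simp only [deckZ, Int.cast_add]
  ring

theorem exists_deckZ_of_annProj_eq {z w : StripA} (h : annProj z = annProj w) :
    ∃ k : ℤ, w = deckZ k z := by
  have h1 : ((w.1 - z.1 : ℝ) : 𝕋) = 0 := by
    rw [AddCircle.coe_sub, sub_eq_zero]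
    exact (congrArg Prod.fst h).symm
  obtain ⟨k, hk⟩ := (AddCircle.coe_eq_zero_iff 1).1 h1
  refine ⟨k, Prod.ext ?_ (congrArg Prod.snd h).symm⟩
  simp only [zsmul_eq_mul, mul_one] at hk
  simp only [deckZ]
  linarith

theorem measurePreserving_deckZ (k : ℤ) : MeasurePreserving (deckZ k) volume volume :=
  (measurePreserving_add_right volume (k : ℝ)).prod (MeasurePreserving.id volume)

theorem AnnulusHomeo.lift_deckZ_s18 (h : AnnulusHomeo) (k : ℤ) (z : StripA) :
    h.lift (deckZ k z) = deckZ k (h.lift z) := by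
  have h1 := add_intCast_of_add_one (g := fun x => (h.lift (x, z.2)).1)
    (fun x => congrArg Prod.fst (h.lift_deck (x, z.2))) z.1 k
  have h2 : ∀ (n : ℕ) (x : ℝ), (h.lift (x + n, z.2)).2 = (h.lift (x, z.2)).2 := by
    intro n
    induction n with
    | zero => simp
    | succ n ih =>
      intro x
      rw [← ih x, Nat.cast_succ, ← add_assoc]
      have e := congrArg Prod.snd (h.lift_deck (x + n, z.2))
      exact e
  refine Prod.ext h1 ?_
  obtain ⟨n, rfl | rfl⟩ := k.eq_nat_or_neg
  · simpa [deckZ] using h2 n z.1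
  · simpa [deckZ, sub_eq_add_neg] using (h2 n (z.1 - n)).symm

/-- The number of translates of `z` lying in `S`. -/
noncomputable def deckCount (S : Set StripA) (z : StripA) : ENNReal :=
  ∑' k : ℤ, S.indicator 1 (deckZ k z)

theorem measurable_deckCount {S : Set StripA} (hS : MeasurableSet S) :
    Measurable (deckCount S) :=
  Measurable.tsum fun k =>
    (measurable_one.indicator hS).comp (measurePreserving_deckZ k).measurable

theorem deckCount_deckZ (S : Set StripA) (l : ℤ) (z : StripA) :
    deckCount S (deckZ l z) = deckCount S z := by
  simp only [deckCount, ← deckZ_add]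
  exact (Equiv.addRight l).tsum_eq fun k => S.indicator 1 (deckZ k z)

theorem deckCount_congr (S : Set StripA) {z w : StripA} (h : annProj z = annProj w) :
    deckCount S z = deckCount S w := by
  obtain ⟨k, rfl⟩ := exists_deckZ_of_annProj_eq h
  exact (deckCount_deckZ S k z).symm

theorem measurePreserving_annProj :
    MeasurePreserving annProj (volume.restrict (Ioc (0 : ℝ) 1 ×ˢ univ)) volume := by
  have h := (AddCircle.measurePreserving_mk 1 0).prod
    (MeasurePreserving.id (volume : Measure (Icc (0 : ℝ) 1)))
  rw [zero_add] at h
  have e : (volume : Measure StripA).restrict (Ioc (0 : ℝ) 1 ×ˢ univ)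
      = (volume.restrict (Ioc (0 : ℝ) 1)).prod volume := by
    rw [Measure.volume_eq_prod, ← Measure.prod_restrict, Measure.restrict_univ]
  rw [e]
  exact h

theorem lintegral_deckCount_annSection {S : Set StripA} (hS : MeasurableSet S) :
    ∫⁻ w : Ann, deckCount S (annSection w) = volume S := by
  have hpush := measurePreserving_annProj.lintegral_comp
    ((measurable_deckCount hS).comp measurable_annSection)
  simp only [Function.comp_apply] at hpush
  rw [← hpush]
  simp only [deckCount_congr S (annProj_annSection (annProj _))]
  simp only [deckCount]
  have hind : ∀ k : ℤ, Measurable fun z => S.indicator (1 : StripA → ENNReal) (deckZ k z) :=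
    fun k => (measurable_one.indicator hS).comp (measurePreserving_deckZ k).measurable
  rw [lintegral_tsum fun k => (hind k).aemeasurable]
  have key : ∀ k : ℤ, ∫⁻ z in Ioc (0 : ℝ) 1 ×ˢ univ, S.indicator 1 (deckZ k z) =
      volume (S ∩ (Ioc (0 + (k : ℝ)) (0 + k + 1) ×ˢ univ)) := by
    intro k
    have hpre : deckZ k ⁻¹' (S ∩ (Ioc (0 + (k : ℝ)) (0 + k + 1) ×ˢ univ)) =
        deckZ k ⁻¹' S ∩ Ioc (0 : ℝ) 1 ×ˢ univ := by
      ext z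
      simp only [deckZ, mem_preimage, mem_inter_iff, mem_prod, mem_Ioc, mem_univ, and_true]
      refine and_congr_right fun _ => ⟨fun h => ⟨?_, ?_⟩, fun h => ⟨?_, ?_⟩⟩ <;> linarith [h.1, h.2]
    rw [← (measurePreserving_deckZ k).measure_preimage
      (hS.inter (measurableSet_Ioc.prod .univ)).nullMeasurableSet, hpre,
      ← Measure.restrict_apply ((measurePreserving_deckZ k).measurable hS),
      ← lintegral_indicator_one ((measurePreserving_deckZ k).measurable hS)]
    rfl
  simp only [key]
  rw [← measure_iUnion, ← inter_iUnion, ← iUnion_prod_const, iUnion_Ioc_add_intCast,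
    univ_prod_univ, inter_univ]
  · intro k l hkl
    refine Disjoint.inter_left' _ (Disjoint.inter_right' _ ?_)
    exact Disjoint.set_prod_left (pairwise_disjoint_Ioc_add_intCast (0 : ℝ) hkl) _ _
  · exact fun k => hS.inter (measurableSet_Ioc.prod .univ)

/-- The lift of an area-preserving annulus homeomorphism preserves area. -/
theorem AnnulusHomeo.measure_preimage_lift (h : AnnulusHomeo)
    (hf : MeasurePreserving h.toFun volume volume) {S : Set StripA} (hS : MeasurableSet S) :
    volume (h.lift ⁻¹' S) = volume S := by
  have hpush := hf.lintegral_comp ((measurable_deckCount hS).comp measurable_annSection)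
  simp only [Function.comp_apply] at hpush
  rw [← lintegral_deckCount_annSection hS,
    ← lintegral_deckCount_annSection (h.lift.continuous.measurable hS), ← hpush]
  refine lintegral_congr fun w => ?_
  have e : deckCount (h.lift ⁻¹' S) (annSection w) = deckCount S (h.lift (annSection w)) := by
    simp only [deckCount, ← h.lift_deckZ_s18]
    rfl
  rw [e]
  refine deckCount_congr S ?_
  rw [h.lift_proj, annProj_annSection, annProj_annSection]

theorem volume_prod_unitInterval (a b c d : ℝ) (hc : 0 ≤ c) (hd : d ≤ 1) :
    volume (Ico a b ×ˢ {y : Icc (0 : ℝ) 1 | c ≤ y ∧ y ≤ d}) =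
      ENNReal.ofReal (b - a) * ENNReal.ofReal (d - c) := by
  have e : ((↑) : Icc (0 : ℝ) 1 → ℝ) '' {y | c ≤ y ∧ y ≤ d} = Icc c d := by
    ext t
    constructor
    · rintro ⟨y, hy, rfl⟩
      exact hy
    · exact fun h => ⟨⟨t, hc.trans h.1, h.2.trans hd⟩, h, rfl⟩
  rw [Measure.volume_eq_prod, Measure.prod_prod, Real.volume_Ico]
  congr 1
  exact unitInterval.volume_apply.trans (by rw [e, Real.volume_Icc])

namespace PositiveTwistMap

variable (f : PositiveTwistMap)

/-- For an area-preserving twist map, the width of a rectangle grows by a definite amount when its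
sides are moved by the two boundary maps. -/
theorem exists_forall_add_le_top_sub_bottom (hf : MeasurePreserving f.toFun volume volume) :
    ∃ ε > 0, ∀ a b, a ≤ b → b - a + ε ≤ f.top b - f.bottom a := by
  set m : Icc (0 : ℝ) 1 := ⟨1 / 2, by norm_num, by norm_num⟩ with hm
  obtain ⟨η, hη, hle⟩ := exists_forall_add_le_of_add_one (u := fun x => (f.lift (x, m)).1)
    f.continuous_bottom (by fun_prop) f.bottom_add_one
    (fun x => congrArg Prod.fst (f.lift_deck (x, m)))
    (fun x => f.strictMono_lift_fst x (show (⟨0, by norm_num⟩ : Icc (0 : ℝ) 1) < m from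
      Subtype.mk_lt_mk.2 (by norm_num)))
  refine ⟨η / 2, by positivity, fun a b hab => ?_⟩
  set Q : Set StripA := Ico a b ×ˢ {y : Icc (0 : ℝ) 1 | (0 : ℝ) ≤ y ∧ y ≤ (1 : ℝ)} with hQ
  set U : Set StripA := Ico (a - η) a ×ˢ {y : Icc (0 : ℝ) 1 | (1 / 2 : ℝ) ≤ y ∧ y ≤ (1 : ℝ)} with hU
  set B : Set StripA := Ico (f.bottom a) (f.top b) ×ˢ
    {y : Icc (0 : ℝ) 1 | (0 : ℝ) ≤ y ∧ y ≤ (1 : ℝ)}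
  have hmeas : ∀ c d s t : ℝ,
      MeasurableSet (Ico c d ×ˢ {y : Icc (0 : ℝ) 1 | s ≤ (y : ℝ) ∧ (y : ℝ) ≤ t}) := fun c d s t =>
    measurableSet_Ico.prod ((measurableSet_le measurable_const measurable_subtype_coe).inter
      (measurableSet_le measurable_subtype_coe measurable_const))
  have hsub : Q ∪ U ⊆ f.lift ⁻¹' B := by
    rintro z (hz | hz)
    · exact ⟨⟨(f.strictMono_bottom.monotone hz.1.1).trans (f.bottom_le_lift_fst z),
        (f.lift_fst_le_top z).trans_lt (f.strictMono_top hz.1.2)⟩, (f.lift z).2.2⟩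
    · refine ⟨⟨?_, (f.lift_fst_le_top z).trans_lt (f.strictMono_top (hz.1.2.trans_le hab))⟩,
        (f.lift z).2.2⟩
      calc f.bottom a ≤ f.bottom (z.1 + η) :=
            f.strictMono_bottom.monotone (by linarith [hz.1.1])
        _ ≤ (f.lift (z.1, m)).1 := hle z.1
        _ ≤ (f.lift z).1 := (f.strictMono_lift_fst z.1).monotone hz.2.1
  have hdisj : Disjoint Q U := Disjoint.set_prod_left
    (Set.disjoint_left.2 fun t h1 h2 => (h1.1.trans_lt h2.2).false) _ _
  have hvol := measure_mono (μ := volume) hsub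
  rw [measure_union hdisj (hmeas _ _ _ _), f.measure_preimage_lift hf (hmeas _ _ _ _), hQ, hU,
    volume_prod_unitInterval _ _ _ _ le_rfl le_rfl, volume_prod_unitInterval _ _ _ _ le_rfl le_rfl,
    volume_prod_unitInterval _ _ _ _ (by norm_num) le_rfl,
    ← ENNReal.ofReal_mul (by linarith), ← ENNReal.ofReal_mul (by linarith),
    ← ENNReal.ofReal_mul' (by norm_num),
    ← ENNReal.ofReal_add (by linarith) (by nlinarith)] at hvol
  by_contra! hlt
  have hpos : 0 < (b - a) * (1 - 0) + (a - (a - η)) * (1 - 1 / 2) := by linarith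
  rcases ENNReal.ofReal_le_ofReal_iff'.1 hvol with h | h <;> linarith

theorem bottom_iterate_le_top_iterate (n : ℕ) (x : ℝ) : f.bottom^[n] x ≤ f.top^[n] x :=
  f.strictMono_bottom.monotone.iterate_le_of_le (fun x => f.bottom_le_lift_fst (bd1 x)) n x

/-- If the orbits of `0` under the boundary maps drift apart at speed at least `ε`, then the
rotation numbers differ by at least `ε`. -/
theorem rotNum_add_le {ρ₀ ρ₁ ε : ℝ} (h0 : HasRotNum0 f.toAnnulusHomeo ρ₀)
    (h1 : HasRotNum1 f.toAnnulusHomeo ρ₁)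
    (h : ∀ n : ℕ, n * ε ≤ f.top^[n] 0 - f.bottom^[n] 0) : ρ₀ + ε ≤ ρ₁ := by
  refine le_of_tendsto_of_tendsto ((h0 0).add_const ε) (h1 0) ?_
  filter_upwards [eventually_gt_atTop 0] with n hn
  have hn' : (0 : ℝ) < n := Nat.cast_pos.2 hn
  rw [f.liftIter_bd0, f.liftIter_bd1, le_div_iff₀ hn', add_mul, div_mul_cancel₀ _ hn'.ne']
  simp only [bd0, bd1]
  linarith [h n]

end PositiveTwistMap

/-- For a positive twist map the rotation number on `C₀` is at most the rotation number
on `C₁`, with strict inequality when the map preserves the area. -/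
theorem statement18 (f : PositiveTwistMap) (ρ₀ ρ₁ : ℝ)
    (h0 : HasRotNum0 f.toAnnulusHomeo ρ₀) (h1 : HasRotNum1 f.toAnnulusHomeo ρ₁) :
    ρ₀ ≤ ρ₁ ∧ (MeasurePreserving f.toFun volume volume → ρ₀ < ρ₁) := by
  refine ⟨?_, fun hf => ?_⟩
  · have := f.rotNum_add_le (ε := 0) h0 h1 fun n => by
      rw [mul_zero, sub_nonneg]
      exact f.bottom_iterate_le_top_iterate n 0
    rwa [add_zero] at this
  · obtain ⟨ε, hε, h⟩ := f.exists_forall_add_le_top_sub_bottom hf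
    have := f.rotNum_add_le (ε := ε) h0 h1 fun n => by
      induction n with
      | zero => simp
      | succ n ih =>
        rw [Function.iterate_succ_apply', Function.iterate_succ_apply']
        have := h _ _ (f.bottom_iterate_le_top_iterate n 0)
        push_cast
        linarith
    linarith
end

section
/- Let f be a positive twist map of the closed annulus A = 𝕋 × [0,1] and let β ∈ (0, π/2) be such that for every z ∈ A the oriented angle from the vertical vector v = (0,1) to Df(z)·v lies in [β−π, −β] and the oriented angle from v to Df(z)⁻¹·v lies in [β, π−β]. Then for every well ordered f-invariant closed set X and all points (x,y), (x',y') in X, one has |y − y'| ≤ cot(β) · d_𝕋(x, x'); in particular the projection p₁ induces a bi-Lipschitz homeomorphism between X and its image p₁(X) ⊆ 𝕋. -/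
open Set Filter Topology MeasureTheory

/-- A vertical segment of the strip as a curve: its image under a differentiable map. -/
lemma hasDerivWithinAt_vertical {F : ℝ × ℝ → ℝ × ℝ} {L : (ℝ × ℝ) →L[ℝ] (ℝ × ℝ)} {x t : ℝ}
    (h : HasFDerivWithinAt F L stripS (x, t)) :
    HasDerivWithinAt (fun s => F (x, s)) (L (0, 1)) (Icc 0 1) t := by
  have h1 : HasDerivWithinAt (fun s : ℝ => (x, s)) ((0 : ℝ), (1 : ℝ)) (Icc 0 1) t :=
    (hasDerivWithinAt_const t (Icc 0 1) x).prodMk (hasDerivWithinAt_id t _)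
  exact h.comp_hasDerivWithinAt t h1 (fun s hs => hs)

lemma HasDerivWithinAt.fst_comp {g : ℝ → ℝ × ℝ} {v : ℝ × ℝ} {s : Set ℝ} {t : ℝ}
    (h : HasDerivWithinAt g v s t) : HasDerivWithinAt (fun r => (g r).1) v.1 s t :=
  (hasFDerivAt_fst (𝕜 := ℝ) (p := g t)).comp_hasDerivWithinAt t h

lemma HasDerivWithinAt.snd_comp {g : ℝ → ℝ × ℝ} {v : ℝ × ℝ} {s : Set ℝ} {t : ℝ}
    (h : HasDerivWithinAt g v s t) : HasDerivWithinAt (fun r => (g r).2) v.2 s t :=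
  (hasFDerivAt_snd (𝕜 := ℝ) (p := g t)).comp_hasDerivWithinAt t h

/-- A differentiable map with a differentiable left inverse sends the top boundary line of the
strip into the boundary of the strip. -/
lemma snd_eq_zero_or_one_of_top {F G : ℝ × ℝ → ℝ × ℝ} {F' G' : ℝ × ℝ → (ℝ × ℝ) →L[ℝ] (ℝ × ℝ)}
    (hF : ∀ z ∈ stripS, HasFDerivWithinAt F (F' z) stripS z)
    (hG : ∀ z ∈ stripS, HasFDerivWithinAt G (G' z) stripS z)
    (mF : MapsTo F stripS stripS) (mG : MapsTo G stripS stripS)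
    (hGF : ∀ z ∈ stripS, G (F z) = z) (x : ℝ) :
    (F (x, 1)).2 = 0 ∨ (F (x, 1)).2 = 1 := by
  have hp : ((x, 1) : ℝ × ℝ) ∈ stripS := ⟨zero_le_one, le_rfl⟩
  have hq := mF hp
  by_contra! hne
  have h0 : 0 < (F (x, 1)).2 := lt_of_le_of_ne hq.1 (Ne.symm hne.1)
  have h1 : (F (x, 1)).2 < 1 := lt_of_le_of_ne hq.2 hne.2
  have hnhds : stripS ∈ 𝓝 (F (x, 1)) :=
    (continuous_snd.tendsto (F (x, 1))).eventually (Icc_mem_nhds h0 h1)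
  have hmax : IsLocalMax (fun w => (G w).2) (F (x, 1)) := by
    filter_upwards [hnhds] with w hw
    rw [hGF _ hp]
    exact (mG hw).2
  have hzero := hmax.hasFDerivAt_eq_zero
    ((hasFDerivAt_snd (𝕜 := ℝ)).comp _ ((hG _ hq).hasFDerivAt hnhds))
  have hcomp := (hasDerivWithinAt_vertical ((hG _ hq).comp _ (hF _ hp) mF)).snd_comp
  have hid : HasDerivWithinAt (fun s : ℝ => ((G ∘ F) (x, s)).2) 1 (Icc 0 1) 1 :=
    (hasDerivWithinAt_id 1 _).congr (fun s hs => by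
      show (G (F (x, s))).2 = s
      rw [hGF (x, s) hs]) (by
      show (G (F (x, 1))).2 = 1
      rw [hGF _ hp])
  have huniq := (uniqueDiffOn_Icc (zero_lt_one (α := ℝ)) 1 ⟨zero_le_one, le_rfl⟩).eq_deriv _
    hcomp hid
  have := congrArg (fun L => L (F' (x, 1) (0, 1))) hzero
  simp at this huniq
  linarith

/-- If the image of the vertical vector stays in the cone of slope `c` around the `σ`-horizontal
direction, then images of vertical segments are `σ`-oriented `c`-Lipschitz graphs. -/
lemma vertical_image_lipschitz_graph {F : ℝ × ℝ → ℝ × ℝ} {F' : ℝ × ℝ → (ℝ × ℝ) →L[ℝ] (ℝ × ℝ)}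
    {c σ : ℝ} (hF : ∀ z ∈ stripS, HasFDerivWithinAt F (F' z) stripS z)
    (hcone : ∀ z ∈ stripS, 0 < σ * (F' z (0, 1)).1 ∧
      |(F' z (0, 1)).2| ≤ c * (σ * (F' z (0, 1)).1)) (x : ℝ) :
    StrictMonoOn (fun t => σ * (F (x, t)).1) (Icc 0 1) ∧
    MonotoneOn (fun t => c * (σ * (F (x, t)).1) - (F (x, t)).2) (Icc 0 1) := by
  have hd : ∀ t ∈ Icc (0:ℝ) 1,
      HasDerivWithinAt (fun s => F (x, s)) (F' (x, t) (0, 1)) (Icc 0 1) t :=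
    fun t ht => hasDerivWithinAt_vertical (hF (x, t) ht)
  have hd1 := fun t ht => (hd t ht).fst_comp.const_mul σ
  have hd2 := fun t ht => ((hd1 t ht).const_mul c).sub (hd t ht).snd_comp
  constructor
  · refine strictMonoOn_of_hasDerivWithinAt_pos (convex_Icc 0 1)
      (fun t ht => (hd1 t ht).continuousWithinAt)
      (fun t ht => (hd1 t (interior_subset ht)).mono interior_subset)
      (fun t ht => (hcone (x, t) (interior_subset (s := Icc (0:ℝ) 1) ht)).1)
  · refine monotoneOn_of_hasDerivWithinAt_nonneg (convex_Icc 0 1)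
      (fun t ht => (hd2 t ht).continuousWithinAt)
      (fun t ht => (hd2 t (interior_subset ht)).mono interior_subset)
      (fun t ht => ?_)
    have := (abs_le.1 (hcone (x, t) (interior_subset (s := Icc (0:ℝ) 1) ht)).2).2
    linarith

/-- A point whose preimage lies on the `σ`-side of a vertical lies below the image of that
vertical, hence satisfies the cone estimate from above. -/
lemma snd_sub_le_of_twist {F G : ℝ × ℝ → ℝ × ℝ} {c σ : ℝ} (hc : 0 ≤ c) (hσ : σ ≠ 0)
    (hcont : ContinuousOn F stripS) (mF : MapsTo F stripS stripS)
    (hGF : ∀ z ∈ stripS, G (F z) = z) (htop : ∀ x, (F (x, 1)).2 = 1)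
    (hmono : ∀ x, MonotoneOn (fun t => c * (σ * (F (x, t)).1) - (F (x, t)).2) (Icc 0 1))
    (hanti : ∀ x, StrictAntiOn (fun t => σ * (G (x, t)).1) (Icc 0 1))
    {p p' : ℝ × ℝ} (hp : p ∈ stripS) (hp' : p' ∈ stripS) (hlt : σ * p.1 < σ * p'.1)
    (hFlt : σ * (F p).1 < σ * (F p').1) :
    (F p').2 - (F p).2 ≤ c * (σ * (F p').1 - σ * (F p).1) := by
  obtain ⟨x, s⟩ := p
  have hs : s ∈ Icc (0:ℝ) 1 := hp
  have h1 : (1:ℝ) ∈ Icc (0:ℝ) 1 := ⟨zero_le_one, le_rfl⟩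
  rcases lt_or_ge (σ * (F (x, 1)).1) (σ * (F p').1) with hb | hb
  · have hm := hmono x hs h1 hs.2
    simp only [htop] at hm
    have hy := (mF hp').2
    have := mul_le_mul_of_nonneg_left hb.le hc
    linarith
  · have hcurve : ContinuousOn (fun t => σ * (F (x, t)).1) (Icc s 1) :=
      continuousOn_const.mul (continuous_fst.comp_continuousOn
        (hcont.comp (by fun_prop) (fun t ht => ⟨hs.1.trans ht.1, ht.2⟩)))
    obtain ⟨t, ht, hte⟩ := intermediate_value_Icc hs.2 hcurve ⟨hFlt.le, hb⟩
    have ht' : t ∈ Icc (0:ℝ) 1 := ⟨hs.1.trans ht.1, ht.2⟩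
    have hxt : ((x, t) : ℝ × ℝ) ∈ stripS := ht'
    have hm := hmono x hs ht' ht.1
    have he : (F (x, t)).1 = (F p').1 := mul_left_cancel₀ hσ hte
    have hbelow : (F p').2 < (F (x, t)).2 := by
      rw [← (hanti (F p').1).lt_iff_gt (mF hxt) (mF hp')]
      have e1 : G ((F p').1, (F (x, t)).2) = (x, t) := by rw [← he]; exact hGF _ hxt
      have e2 : G ((F p').1, (F p').2) = p' := hGF _ hp'
      simpa only [e1, e2] using hlt
    simp only [he] at hm
    linarith

lemma cone_of_angleFromVertical_neg {β : ℝ} (hβ : β ∈ Ioo (0:ℝ) (Real.pi / 2)) {w : ℝ × ℝ}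
    (h : angleFromVertical w ∈ Icc (β - Real.pi) (-β)) :
    0 < 1 * w.1 ∧ |w.2| ≤ Real.cot β * (1 * w.1) := by
  set u : ℂ := ⟨w.2, -w.1⟩ with hu
  have hs : 0 < Real.sin β := Real.sin_pos_of_pos_of_lt_pi hβ.1 (by linarith [hβ.2, hβ.1])
  have hre : ‖u‖ * Real.cos u.arg = w.2 := Complex.norm_mul_cos_arg u
  have him : ‖u‖ * Real.sin u.arg = -w.1 := Complex.norm_mul_sin_arg u
  change u.arg ∈ _ at h
  have hu0 : 0 < ‖u‖ := by
    rw [norm_pos_iff]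
    intro h0
    rw [h0, Complex.arg_zero] at h
    linarith [h.2, hβ.1]
  have hpi := hβ.2
  have hpos := hβ.1
  have hcosneg : |Real.cos u.arg| ≤ Real.cos β := by
    rw [← Real.cos_neg u.arg, abs_le]
    constructor
    · rw [← Real.cos_pi_sub]
      exact Real.cos_le_cos_of_nonneg_of_le_pi (by linarith [h.2]) (by linarith)
        (by linarith [h.1])
    · exact Real.cos_le_cos_of_nonneg_of_le_pi hpos.le (by linarith [h.1]) (by linarith [h.2])
  have hsin : Real.sin β ≤ -Real.sin u.arg := by
    have hneg : Real.sin u.arg ≤ 0 :=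
      Real.sin_nonpos_of_nonpos_of_neg_pi_le (by linarith [h.2]) (by linarith [h.1])
    have hsq := sq_le_sq' (abs_le.1 hcosneg).1 (abs_le.1 hcosneg).2
    have := Real.sin_sq_add_cos_sq u.arg
    have := Real.sin_sq_add_cos_sq β
    nlinarith
  have hw : ‖u‖ * Real.sin β ≤ w.1 := by nlinarith
  refine ⟨by nlinarith, ?_⟩
  rw [← hre, abs_mul, abs_of_pos hu0, Real.cot_eq_cos_div_sin, one_mul, div_mul_eq_mul_div,
    le_div_iff₀ hs]
  have hcb : 0 ≤ Real.cos β := (abs_nonneg _).trans hcosneg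
  calc ‖u‖ * |Real.cos u.arg| * Real.sin β ≤ ‖u‖ * Real.cos β * Real.sin β := by gcongr
    _ = Real.cos β * (‖u‖ * Real.sin β) := by ring
    _ ≤ Real.cos β * w.1 := by gcongr

lemma cone_of_angleFromVertical_pos {β : ℝ} (hβ : β ∈ Ioo (0:ℝ) (Real.pi / 2)) {w : ℝ × ℝ}
    (h : angleFromVertical w ∈ Icc β (Real.pi - β)) :
    0 < -1 * w.1 ∧ |w.2| ≤ Real.cot β * (-1 * w.1) := by
  have hconj : angleFromVertical (-w.1, w.2) = -angleFromVertical w := by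
    have hne : (⟨w.2, -w.1⟩ : ℂ).arg ≠ Real.pi := fun h' => by
      have := h.2
      rw [angleFromVertical, h'] at this
      linarith [hβ.1]
    have := Complex.arg_conj (⟨w.2, -w.1⟩ : ℂ)
    rw [if_neg hne] at this
    exact this
  have := cone_of_angleFromVertical_neg hβ (w := (-w.1, w.2))
    (by rw [hconj]; exact ⟨by linarith [h.2], by linarith [h.1]⟩)
  simpa using this

namespace PositiveTwistMap

variable (f : PositiveTwistMap)

lemma mapsTo_F : MapsTo f.F stripS stripS := fun z hz => by
  have := f.F_lift (z.1, ⟨z.2, hz⟩)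
  simp only [Prod.mk.eta] at this
  rw [this]
  exact (f.lift (z.1, ⟨z.2, hz⟩)).2.2

lemma mapsTo_G : MapsTo f.G stripS stripS := fun z hz => by
  have := f.G_lift (z.1, ⟨z.2, hz⟩)
  simp only [Prod.mk.eta] at this
  rw [this]
  exact (f.lift.symm (z.1, ⟨z.2, hz⟩)).2.2

lemma G_F (z : ℝ × ℝ) (hz : z ∈ stripS) : f.G (f.F z) = z := by
  have h := f.F_lift (z.1, ⟨z.2, hz⟩)
  simp only [Prod.mk.eta] at h
  rw [h, f.G_lift, Homeomorph.symm_apply_apply]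

lemma F_G (z : ℝ × ℝ) (hz : z ∈ stripS) : f.F (f.G z) = z := by
  have h := f.G_lift (z.1, ⟨z.2, hz⟩)
  simp only [Prod.mk.eta] at h
  rw [h, f.F_lift, Homeomorph.apply_symm_apply]

lemma continuousOn_F : ContinuousOn f.F stripS :=
  fun z hz => (f.F_hasDeriv z hz).continuousWithinAt

lemma continuousOn_G : ContinuousOn f.G stripS :=
  fun z hz => (f.G_hasDeriv z hz).continuousWithinAt

lemma G_top (x : ℝ) : (f.G (x, 1)).2 = 1 := by
  rcases snd_eq_zero_or_one_of_top f.G_hasDeriv f.F_hasDeriv f.mapsTo_G f.mapsTo_F f.F_G x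
    with h | h
  · have hp : ((x, 1) : ℝ × ℝ) ∈ stripS := ⟨zero_le_one, le_rfl⟩
    have hl := f.F_lift ((f.G (x, 1)).1, ⟨(f.G (x, 1)).2, f.mapsTo_G hp⟩)
    have hb := f.lift_bd0 ((f.G (x, 1)).1, ⟨(f.G (x, 1)).2, f.mapsTo_G hp⟩) h
    simp only [Prod.mk.eta, f.F_G _ hp] at hl
    have := congrArg Prod.snd hl
    simp only [hb] at this
    exact absurd this one_ne_zero
  · exact h

lemma F_top (x : ℝ) : (f.F (x, 1)).2 = 1 := by
  have hdich := snd_eq_zero_or_one_of_top f.F_hasDeriv f.G_hasDeriv f.mapsTo_F f.mapsTo_G f.G_F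
  refine (hdich x).resolve_left fun h0 => ?_
  have hp : ((0, 1) : ℝ × ℝ) ∈ stripS := ⟨zero_le_one, le_rfl⟩
  have h1 : (f.F ((f.G (0, 1)).1, 1)).2 = 1 := by
    have : ((f.G (0, 1)).1, (1:ℝ)) = f.G (0, 1) := Prod.ext rfl (f.G_top 0).symm
    rw [this, f.F_G _ hp]
  have hcont : Continuous fun u : ℝ => (f.F (u, 1)).2 :=
    continuous_snd.comp (f.continuousOn_F.comp_continuous (by fun_prop)
      fun u => ⟨zero_le_one, le_rfl⟩)
  obtain ⟨u, hu⟩ := mem_range_of_exists_le_of_exists_ge hcont (c := 1 / 2)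
    ⟨x, by rw [h0]; norm_num⟩ ⟨_, by rw [h1]; norm_num⟩
  rcases hdich u with h | h <;> simp only [h] at hu <;> norm_num at hu

/-- The order of a well ordered set is preserved by the lift and its inverse, so both cone estimates apply to any two of
its points. -/
lemma abs_snd_sub_le {β : ℝ} (hβ : β ∈ Ioo (0:ℝ) (Real.pi / 2))
    (hDf : ∀ z ∈ stripS, angleFromVertical (f.F' z (0, 1)) ∈ Icc (β - Real.pi) (-β))
    (hDfinv : ∀ z ∈ stripS, angleFromVertical (f.G' (f.F z) (0, 1)) ∈ Icc β (Real.pi - β))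
    {X : Set Ann} (hwo : IsWellOrdered f.toAnnulusHomeo X) {z z' : StripA}
    (hz : annProj z ∈ X) (hz' : annProj z' ∈ X) (hlt : z.1 < z'.1) :
    |(z.2 : ℝ) - (z'.2 : ℝ)| ≤ Real.cot β * (z'.1 - z.1) := by
  obtain ⟨-, hinv, hinj, hord⟩ := hwo
  have hc : 0 ≤ Real.cot β := by
    rw [Real.cot_eq_cos_div_sin]
    exact div_nonneg
      (Real.cos_nonneg_of_neg_pi_div_two_le_of_le (by linarith [hβ.1, hβ.2]) hβ.2.le)
      (Real.sin_nonneg_of_nonneg_of_le_pi hβ.1.le (by linarith [hβ.1, hβ.2]))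
  have coneF := fun z hz => cone_of_angleFromVertical_neg hβ (hDf z hz)
  have coneG : ∀ z ∈ stripS, 0 < -1 * (f.G' z (0, 1)).1 ∧
      |(f.G' z (0, 1)).2| ≤ Real.cot β * (-1 * (f.G' z (0, 1)).1) := fun z hz => by
    have := hDfinv (f.G z) (f.mapsTo_G hz)
    rw [f.F_G z hz] at this
    exact cone_of_angleFromVertical_pos hβ this
  have graphF := vertical_image_lipschitz_graph f.F_hasDeriv coneF
  have graphG := vertical_image_lipschitz_graph f.G_hasDeriv coneG
  have antiF : ∀ x, StrictAntiOn (fun t => -1 * (f.F (x, t)).1) (Icc 0 1) := fun x s hs t ht h => by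
    have := (graphF x).1 hs ht h
    simp only at this ⊢
    linarith
  have antiG : ∀ x, StrictAntiOn (fun t => 1 * (f.G (x, t)).1) (Icc 0 1) := fun x s hs t ht h => by
    have := (graphG x).1 hs ht h
    simp only at this ⊢
    linarith
  have hpre : ∀ w : StripA, annProj w ∈ X → annProj (f.lift.symm w) ∈ X := fun w hw => by
    rw [← hinv] at hw
    obtain ⟨a, ha, hae⟩ := hw
    have := f.lift_proj (f.lift.symm w)
    rw [Homeomorph.apply_symm_apply, ← hae] at this
    rwa [← f.toFun.injective this]
  have hltG : (f.lift.symm z).1 < (f.lift.symm z').1 := by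
    by_contra! hle
    rcases hle.lt_or_eq with h | h
    · have := hord _ _ (hpre z' hz') (hpre z hz) h
      rw [Homeomorph.apply_symm_apply, Homeomorph.apply_symm_apply] at this
      exact lt_asymm hlt this
    · have h1 : annProj (f.lift.symm z') = annProj (f.lift.symm z) :=
        hinj (hpre z' hz') (hpre z hz) (congrArg (fun r : ℝ => (r : 𝕋)) h)
      have h2 : f.lift.symm z' = f.lift.symm z :=
        Prod.ext h (congrArg (fun w : Ann => w.2) h1)
      exact hlt.ne' (congrArg Prod.fst (f.lift.symm.injective h2))
  have hltF := hord z z' hz hz' hlt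
  have upper := snd_sub_le_of_twist hc one_ne_zero f.continuousOn_F f.mapsTo_F f.G_F f.F_top
    (fun x => (graphF x).2) antiG
    (p := ((f.lift.symm z).1, ((f.lift.symm z).2 : ℝ)))
    (p' := ((f.lift.symm z').1, ((f.lift.symm z').2 : ℝ)))
    (f.lift.symm z).2.2 (f.lift.symm z').2.2 (by simpa using hltG)
    (by simpa [f.F_lift] using hlt)
  have lower := snd_sub_le_of_twist hc (neg_ne_zero.2 one_ne_zero) f.continuousOn_G f.mapsTo_G
    f.F_G f.G_top (fun x => (graphG x).2) antiF
    (p := ((f.lift z').1, ((f.lift z').2 : ℝ)))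
    (p' := ((f.lift z).1, ((f.lift z).2 : ℝ)))
    (f.lift z').2.2 (f.lift z).2.2 (by simpa using hltF)
    (by simpa [f.G_lift] using hlt)
  simp only [f.F_lift, f.G_lift, Homeomorph.apply_symm_apply, Homeomorph.symm_apply_apply]
    at upper lower
  rw [abs_le]
  constructor <;> linarith

end PositiveTwistMap

/-- Two points of the circle have lifts at the same distance. -/
lemma exists_lifts_dist_eq (a b : 𝕋) :
    ∃ x y : ℝ, (x : 𝕋) = a ∧ (y : 𝕋) = b ∧ dist a b = |x - y| := by
  obtain ⟨x, rfl⟩ := QuotientAddGroup.mk_surjective a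
  obtain ⟨y, rfl⟩ := QuotientAddGroup.mk_surjective b
  refine ⟨x, y + round (x - y), rfl, ?_, ?_⟩
  · have : ((round (x - y) : ℝ) : 𝕋) = 0 := by
      rw [AddCircle.coe_eq_zero_iff]
      exact ⟨round (x - y), by simp⟩
    rw [AddCircle.coe_add, this, add_zero]
  · rw [dist_eq_norm]
    change ‖((x - y : ℝ) : 𝕋)‖ = _
    rw [AddCircle.norm_eq]
    simp [sub_sub]

/-- On a well ordered invariant closed set of a positive twist map with twist angles
bounded by `β`, the vertical coordinate is a `cot β`-Lipschitz function of the horizontal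
one; in particular the first projection induces a bi-Lipschitz homeomorphism onto its
image. -/
theorem statement19 (f : PositiveTwistMap) (β : ℝ) (hβ : β ∈ Set.Ioo (0:ℝ) (Real.pi / 2))
    (hDf : ∀ z ∈ stripS, angleFromVertical (f.F' z (0, 1)) ∈ Set.Icc (β - Real.pi) (-β))
    (hDfinv : ∀ z ∈ stripS,
      angleFromVertical (f.G' (f.F z) (0, 1)) ∈ Set.Icc β (Real.pi - β))
    (X : Set Ann) (hwo : IsWellOrdered f.toAnnulusHomeo X) :
    (∀ z ∈ X, ∀ z' ∈ X,
      |(z.2 : ℝ) - (z'.2 : ℝ)| ≤ Real.cot β * dist z.1 z'.1) ∧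
    ∃ K : ℝ, ∀ z ∈ X, ∀ z' ∈ X,
      dist z.1 z'.1 ≤ dist z z' ∧ dist z z' ≤ K * dist z.1 z'.1 := by
  have key : ∀ z ∈ X, ∀ z' ∈ X,
      |(z.2 : ℝ) - (z'.2 : ℝ)| ≤ Real.cot β * dist z.1 z'.1 := by
    rintro ⟨a, s⟩ hz ⟨b, t⟩ hz'
    obtain ⟨x, y, rfl, rfl, hd⟩ := exists_lifts_dist_eq a b
    simp only [hd]
    rcases lt_trichotomy x y with h | rfl | h
    · have := f.abs_snd_sub_le hβ hDf hDfinv hwo (z := (x, s)) (z' := (y, t)) hz hz' h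
      rwa [abs_sub_comm x y, abs_of_pos (sub_pos.2 h)]
    · have : s = t := congrArg Prod.snd (hwo.2.2.1 hz hz' rfl)
      simp [this]
    · have := f.abs_snd_sub_le hβ hDf hDfinv hwo (z := (y, t)) (z' := (x, s)) hz' hz h
      rwa [abs_sub_comm (s : ℝ), abs_of_pos (sub_pos.2 h)]
  refine ⟨key, max 1 (Real.cot β), fun z hz z' hz' => ⟨le_max_left _ _, ?_⟩⟩
  rw [Prod.dist_eq]
  refine max_le ?_ ?_
  · exact le_mul_of_one_le_left dist_nonneg (le_max_left _ _)
  · exact (key z hz z' hz').trans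
      (mul_le_mul_of_nonneg_right (le_max_right _ _) dist_nonneg)
end
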